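/- If A ≤_T B′ and A ≤_LR B, then every Π^A_1 class in Cantor space has a Σ^B_2 subclass of the same μ-measure. -/

import Mathlib

open MeasureTheory Filter

namespace LMD

/-- Codes for partial functions recursive in an oracle. -/
inductive OracleCode : Type
  | zero : OracleCode
  | succ : OracleCode
  | left : OracleCode
  | right : OracleCode
  | oracle : OracleCode
  | pair : OracleCode → OracleCode → OracleCode
  | comp : OracleCode → OracleCode → OracleCode
  | prec : OracleCode → OracleCode → OracleCode
  | rfind' : OracleCode → OracleCode

namespace OracleCode

/-- Evaluation of an oracle code relative to a (total) oracle `O : ℕ → ℕ`. -/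
def eval (O : ℕ → ℕ) : OracleCode → ℕ →. ℕ
  | zero => pure 0
  | succ => Nat.succ
  | left => ↑fun n : ℕ => n.unpair.1
  | right => ↑fun n : ℕ => n.unpair.2
  | oracle => ↑fun n : ℕ => O n
  | pair cf cg => fun n => Nat.pair <$> eval O cf n <*> eval O cg n
  | comp cf cg => fun n => eval O cg n >>= eval O cf
  | prec cf cg =>
    Nat.unpaired fun a n =>
      n.rec (eval O cf a) fun y IH => do
        let i ← IH
        eval O cg (Nat.pair a (Nat.pair y i))
  | rfind' cf =>
    Nat.unpaired fun a m =>
      (Nat.rfind fun n => (fun m => m = 0) <$> eval O cf (Nat.pair a (n + m))).map (· + m)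

/-- A Gödel numbering of oracle codes. -/
def encodeCode : OracleCode → ℕ
  | zero => 0
  | succ => 1
  | left => 2
  | right => 3
  | oracle => 4
  | pair cf cg => 4 * Nat.pair (encodeCode cf) (encodeCode cg) + 5
  | comp cf cg => 4 * Nat.pair (encodeCode cf) (encodeCode cg) + 6
  | prec cf cg => 4 * Nat.pair (encodeCode cf) (encodeCode cg) + 7
  | rfind' cf => 4 * encodeCode cf + 8

end OracleCode

/-- `f` is partial recursive in the oracle `O`. -/
def RecursiveIn (O : ℕ → ℕ) (f : ℕ →. ℕ) : Prop := ∃ c : OracleCode, c.eval O = f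

/-- The characteristic function of a set of naturals. -/
noncomputable def chi (A : Set ℕ) : ℕ → ℕ := A.indicator fun _ => 1

/-- Turing reducibility between sets of naturals. -/
def TuringLE (A B : Set ℕ) : Prop := RecursiveIn (chi B) (chi A)

/-- The Turing jump of a set of naturals. -/
def jump (B : Set ℕ) : Set ℕ :=
  {e | ∃ c : OracleCode, c.encodeCode = e ∧ (c.eval (chi B) e).Dom}

/-- The open subset of Cantor space generated by a set of finite binary strings. -/
def Cyl (W : Set (List Bool)) : Set (ℕ → Bool) :=
  {X | ∃ σ ∈ W, ∀ i : Fin σ.length, X i = σ.get i}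

/-- The fair-coin product measure on Cantor space, realized as the pushforward of
Lebesgue measure on `[0,1)` under the binary expansion map. -/
noncomputable def mu : Measure (ℕ → Bool) :=
  Measure.map (fun x n => decide (⌊x * 2 ^ (n + 1)⌋₊ % 2 = 1))
    (volume.restrict (Set.Ico (0 : ℝ) 1))

/-- `W` is a c.e.-in-`A` set of binary strings. -/
def CeIn (A : Set ℕ) (W : Set (List Bool)) : Prop :=
  ∃ c : OracleCode, ∀ σ : List Bool, σ ∈ W ↔ (c.eval (chi A) (Encodable.encode σ)).Dom

/-- `W` is a uniformly c.e.-in-`A` sequence of sets of binary strings. -/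
def CeSeqIn (A : Set ℕ) (W : ℕ → Set (List Bool)) : Prop :=
  ∃ c : OracleCode, ∀ (n : ℕ) (σ : List Bool),
    σ ∈ W n ↔ (c.eval (chi A) (Nat.pair n (Encodable.encode σ))).Dom

/-- A Martin-Löf test relative to `A`. -/
def MLTest (A : Set ℕ) (U : ℕ → Set (ℕ → Bool)) : Prop :=
  ∃ W : ℕ → Set (List Bool), CeSeqIn A W ∧ (∀ n, U n = Cyl (W n)) ∧
    (∀ n, U (n + 1) ⊆ U n) ∧ ∀ n, mu (U n) ≤ 2⁻¹ ^ n

/-- `X` is Martin-Löf random relative to `A`. -/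
def MLRandom (A : Set ℕ) (X : ℕ → Bool) : Prop :=
  ∀ U : ℕ → Set (ℕ → Bool), MLTest A U → X ∉ ⋂ n, U n

/-- `A ≤_LR B`: every `B`-random is `A`-random. -/
def LRle (A B : Set ℕ) : Prop := ∀ X : ℕ → Bool, MLRandom B X → MLRandom A X

/-- Evaluation of an oracle machine on binary strings. -/
def evalStr (c : OracleCode) (O : ℕ → ℕ) (σ : List Bool) : Part (List Bool) :=
  (c.eval O (Encodable.encode σ)).bind fun m => Part.ofOption (Encodable.decode m)

/-- `c` is a prefix-free oracle machine: for every oracle its domain is prefix-free. -/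
def PrefixFreeMachine (c : OracleCode) : Prop :=
  ∀ (O : ℕ → ℕ) (σ₁ σ₂ : List Bool), σ₁ <+: σ₂ →
    (evalStr c O σ₁).Dom → (evalStr c O σ₂).Dom → σ₁ = σ₂

/-- `u` is a universal prefix-free oracle machine. -/
def UniversalPFM (u : OracleCode) : Prop :=
  PrefixFreeMachine u ∧
    ∀ c : OracleCode, PrefixFreeMachine c → ∃ d : ℕ, ∀ (O : ℕ → ℕ) (σ τ : List Bool),
      τ ∈ evalStr c O σ → ∃ σ' : List Bool, τ ∈ evalStr u O σ' ∧ σ'.length ≤ σ.length + d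

/-- Prefix-free Kolmogorov complexity relative to the oracle `O`,
measured by the universal machine `u` (`⊤` if `τ` is not in the range). -/
noncomputable def K (u : OracleCode) (O : ℕ → ℕ) (τ : List Bool) : ℕ∞ :=
  ⨅ σ ∈ {σ : List Bool | τ ∈ evalStr u O σ}, (σ.length : ℕ∞)

/-- `A ≤_LK B` with respect to the universal machine `u`. -/
def LKle (u : OracleCode) (A B : Set ℕ) : Prop :=
  ∃ d : ℕ, ∀ τ : List Bool, K u (chi B) τ ≤ K u (chi A) τ + (d : ℕ∞)


/-- A `Σ^A_1` class in Cantor space. -/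
def Sigma1In (A : Set ℕ) (S : Set (ℕ → Bool)) : Prop :=
  ∃ W : Set (List Bool), CeIn A W ∧ S = Cyl W

/-- A `Π^A_1` class in Cantor space. -/
def Pi1In (A : Set ℕ) (S : Set (ℕ → Bool)) : Prop :=
  ∃ W : Set (List Bool), CeIn A W ∧ S = (Cyl W)ᶜ

/-- A `Σ^A_2` class: a union of a uniformly `Π^A_1` sequence of classes. -/
def Sigma2In (A : Set ℕ) (S : Set (ℕ → Bool)) : Prop :=
  ∃ W : ℕ → Set (List Bool), CeSeqIn A W ∧ S = ⋃ n, (Cyl (W n))ᶜ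

/-- A `Π^A_2` class: an intersection of a uniformly `Σ^A_1` sequence of classes. -/
def Pi2In (A : Set ℕ) (S : Set (ℕ → Bool)) : Prop :=
  ∃ W : ℕ → Set (List Bool), CeSeqIn A W ∧ S = ⋂ n, Cyl (W n)

/-! ### Primitive recursive predicates -/

section Primrec

variable {α β : Type*} [Primcodable α] [Primcodable β]

theorem primrecPred_exists_mem {f : α → List β} {p : α → β → Prop} (hf : Primrec f)
    (hp : PrimrecPred fun q : α × β => p q.1 q.2) : PrimrecPred fun a => ∃ b ∈ f a, p a b := by
  have h : PrimrecRel fun (b : β) (a : α) => p a b :=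
    hp.comp (Primrec.pair Primrec.snd Primrec.fst)
  exact (PrimrecRel.exists_mem_list h).comp hf Primrec.id

theorem primrecPred_forall_mem {f : α → List β} {p : α → β → Prop} (hf : Primrec f)
    (hp : PrimrecPred fun q : α × β => p q.1 q.2) : PrimrecPred fun a => ∀ b ∈ f a, p a b := by
  have h : PrimrecRel fun (b : β) (a : α) => p a b :=
    hp.comp (Primrec.pair Primrec.snd Primrec.fst)
  exact (PrimrecRel.forall_mem_list h).comp hf Primrec.id

theorem primrecPred_exists_lt {f : α → ℕ} {p : α → ℕ → Prop} (hf : Primrec f)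
    (hp : PrimrecPred fun q : α × ℕ => p q.1 q.2) : PrimrecPred fun a => ∃ n < f a, p a n := by
  exact (primrecPred_exists_mem (p := p) (Primrec.list_range.comp hf) hp).of_eq fun a => by simp

theorem primrecPred_forall_lt {f : α → ℕ} {p : α → ℕ → Prop} (hf : Primrec f)
    (hp : PrimrecPred fun q : α × ℕ => p q.1 q.2) : PrimrecPred fun a => ∀ n < f a, p a n := by
  exact (primrecPred_forall_mem (p := p) (Primrec.list_range.comp hf) hp).of_eq fun a => by simp

theorem primrecPred_exists_mem_option {f : α → Option β} {p : α → β → Prop} (hf : Primrec f)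
    (hp : PrimrecPred fun q : α × β => p q.1 q.2) : PrimrecPred fun a => ∃ b ∈ f a, p a b := by
  have h : Primrec fun a => (f a).toList :=
    Primrec.of_eq (f := fun a => Option.casesOn (f a) [] fun b => [b])
      (Primrec.option_casesOn hf (Primrec.const [])
        (Primrec.list_cons.comp Primrec.snd (Primrec.const [])).to₂)
      fun a => by cases f a <;> rfl
  exact (primrecPred_exists_mem h hp).of_eq fun a => by simp [Option.mem_toList]

end Primrec

/-! ### Evaluation of oracle codes through finite parts of the oracle -/

open Nat.Partrec (Code)

/-- The list of the first `k` values of `O`. -/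
def pre {γ : Type*} (O : ℕ → γ) (k : ℕ) : List γ := (List.range k).map O

section Pre

variable {γ : Type*} (O : ℕ → γ)

@[simp] theorem length_pre (k : ℕ) : (pre O k).length = k := by simp [pre]

theorem pre_succ (k : ℕ) : pre O (k + 1) = pre O k ++ [O k] := by
  simp [pre, List.range_succ]

theorem getElem?_pre {k n : ℕ} (h : n < k) : (pre O k)[n]? = some (O n) := by
  simp [pre, h]

theorem getElem?_pre_eq_some {k n : ℕ} {y : γ} :
    (pre O k)[n]? = some y ↔ n < k ∧ O n = y := by
  by_cases h : n < k
  · rw [getElem?_pre O h]; simp [h]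
  · simp [pre, h]

theorem take_pre {j k : ℕ} (h : j ≤ k) : (pre O k).take j = pre O j := by
  simp [pre, ← List.map_take, List.take_range, h]

theorem pre_prefix_pre {j k : ℕ} (h : j ≤ k) : pre O j <+: pre O k := by
  rw [← take_pre O h]; exact List.take_prefix _ _

theorem eq_pre_of_prefix {l : List γ} {k : ℕ} (h : l <+: pre O k) : l = pre O l.length := by
  have hl : l.length ≤ k := by simpa using h.length_le
  rw [← take_pre O hl]; exact List.prefix_iff_eq_take.mp h

end Pre

namespace OracleCode

/-- The oracle code with a given Gödel number. -/
def ofNum : ℕ → OracleCode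
  | 0 => zero
  | 1 => succ
  | 2 => left
  | 3 => right
  | 4 => oracle
  | n + 5 =>
    have : (n / 4).unpair.1 < n + 5 :=
      lt_of_le_of_lt ((Nat.unpair_left_le _).trans (Nat.div_le_self _ _)) (by omega)
    have : (n / 4).unpair.2 < n + 5 :=
      lt_of_le_of_lt ((Nat.unpair_right_le _).trans (Nat.div_le_self _ _)) (by omega)
    have : n / 4 < n + 5 := lt_of_le_of_lt (Nat.div_le_self _ _) (by omega)
    if n % 4 = 0 then pair (ofNum (n / 4).unpair.1) (ofNum (n / 4).unpair.2)
    else if n % 4 = 1 then comp (ofNum (n / 4).unpair.1) (ofNum (n / 4).unpair.2)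
    else if n % 4 = 2 then prec (ofNum (n / 4).unpair.1) (ofNum (n / 4).unpair.2)
    else rfind' (ofNum (n / 4))

theorem encodeCode_ofNum (e : ℕ) : (ofNum e).encodeCode = e := by
  induction e using Nat.strong_induction_on with
  | _ e ih =>
    match e with
    | 0 => simp [ofNum, encodeCode]
    | 1 => simp [ofNum, encodeCode]
    | 2 => simp [ofNum, encodeCode]
    | 3 => simp [ofNum, encodeCode]
    | 4 => simp [ofNum, encodeCode]
    | n + 5 =>
      have h1 := ih (n / 4).unpair.1
        (lt_of_le_of_lt ((Nat.unpair_left_le _).trans (Nat.div_le_self _ _)) (by omega))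
      have h2 := ih (n / 4).unpair.2
        (lt_of_le_of_lt ((Nat.unpair_right_le _).trans (Nat.div_le_self _ _)) (by omega))
      have h3 := ih (n / 4) (lt_of_le_of_lt (Nat.div_le_self _ _) (by omega))
      rw [ofNum]
      split_ifs <;> simp only [encodeCode, h1, h2, h3, Nat.pair_unpair] <;> omega

theorem ofNum_encodeCode (c : OracleCode) : ofNum c.encodeCode = c := by
  induction c with
  | zero => simp [ofNum, encodeCode]
  | succ => simp [ofNum, encodeCode]
  | left => simp [ofNum, encodeCode]
  | right => simp [ofNum, encodeCode]
  | oracle => simp [ofNum, encodeCode]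
  | pair cf cg hf hg =>
    rw [encodeCode, ofNum]
    have h : 4 * Nat.pair cf.encodeCode cg.encodeCode / 4 = _ := Nat.mul_div_cancel_left _ (by simp)
    simp [h, hf, hg]
  | comp cf cg hf hg =>
    rw [encodeCode, ofNum]
    have h : (4 * Nat.pair cf.encodeCode cg.encodeCode + 1) / 4 =
      Nat.pair cf.encodeCode cg.encodeCode := by omega
    simp [h, hf, hg, Nat.add_mod]
  | prec cf cg hf hg =>
    rw [encodeCode, ofNum]
    have h : (4 * Nat.pair cf.encodeCode cg.encodeCode + 2) / 4 =
      Nat.pair cf.encodeCode cg.encodeCode := by omega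
    simp [h, hf, hg, Nat.add_mod]
  | rfind' cf hf =>
    rw [encodeCode, ofNum]
    have h : (4 * cf.encodeCode + 3) / 4 = cf.encodeCode := by omega
    simp [h, hf, Nat.add_mod]

/-- Replace the oracle by the partial recursive function with code `u`. -/
def toCode (u : Code) : OracleCode → Code
  | zero => .zero
  | succ => .succ
  | left => .left
  | right => .right
  | oracle => u
  | pair cf cg => .pair (toCode u cf) (toCode u cg)
  | comp cf cg => .comp (toCode u cf) (toCode u cg)
  | prec cf cg => .prec (toCode u cf) (toCode u cg)
  | rfind' cf => .rfind' (toCode u cf)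

theorem mem_eval_rfind' {O : ℕ → ℕ} {cf : OracleCode} {x y : ℕ} :
    y ∈ (rfind' cf).eval O x ↔ ∃ a, (0 ∈ cf.eval O (Nat.pair x.unpair.1 (a + x.unpair.2)) ∧
      ∀ m < a, ∃ w ∈ cf.eval O (Nat.pair x.unpair.1 (m + x.unpair.2)), w ≠ 0) ∧
      a + x.unpair.2 = y := by
  change y ∈ Part.map _ (Nat.rfind fun n => Part.map (fun m => decide (m = 0)) _) ↔ _
  rw [Part.mem_map_iff]
  refine exists_congr fun a => and_congr_left fun _ => ?_
  exact Nat.mem_rfind.trans (and_congr ((Part.mem_map_iff _).trans (by simp))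
    (forall₂_congr fun m _ => (Part.mem_map_iff _).trans (by simp)))

theorem mem_codeEval_rfind' {cf : Code} {x y : ℕ} :
    y ∈ (Code.rfind' cf).eval x ↔ ∃ a, (0 ∈ cf.eval (Nat.pair x.unpair.1 (a + x.unpair.2)) ∧
      ∀ m < a, ∃ w ∈ cf.eval (Nat.pair x.unpair.1 (m + x.unpair.2)), w ≠ 0) ∧
      a + x.unpair.2 = y := by
  change y ∈ Part.map _ (Nat.rfind fun n => Part.map (fun m => decide (m = 0)) _) ↔ _
  rw [Part.mem_map_iff]
  refine exists_congr fun a => and_congr_left fun _ => ?_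
  exact Nat.mem_rfind.trans (and_congr ((Part.mem_map_iff _).trans (by simp))
    (forall₂_congr fun m _ => (Part.mem_map_iff _).trans (by simp)))

theorem mem_eval_pair {O : ℕ → ℕ} {cf cg : OracleCode} {x y : ℕ} :
    y ∈ (pair cf cg).eval O x ↔ ∃ a ∈ cf.eval O x, ∃ b ∈ cg.eval O x, Nat.pair a b = y := by
  change y ∈ Part.bind (Part.map Nat.pair (cf.eval O x)) (fun f => Part.map f (cg.eval O x)) ↔ _
  simp

theorem mem_codeEval_pair {cf cg : Code} {x y : ℕ} :
    y ∈ (Code.pair cf cg).eval x ↔ ∃ a ∈ cf.eval x, ∃ b ∈ cg.eval x, Nat.pair a b = y := by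
  change y ∈ Part.bind (Part.map Nat.pair (cf.eval x)) (fun f => Part.map f (cg.eval x)) ↔ _
  simp

theorem mem_eval_comp {O : ℕ → ℕ} {cf cg : OracleCode} {x y : ℕ} :
    y ∈ (comp cf cg).eval O x ↔ ∃ a ∈ cg.eval O x, y ∈ cf.eval O a :=
  Part.mem_bind_iff

theorem mem_codeEval_comp {cf cg : Code} {x y : ℕ} :
    y ∈ (Code.comp cf cg).eval x ↔ ∃ a ∈ cg.eval x, y ∈ cf.eval a :=
  Part.mem_bind_iff

theorem mem_eval_of_mem_eval_toCode {u : Code} {O : ℕ → ℕ}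
    (hu : ∀ n, ∀ y ∈ u.eval n, y = O n) :
    ∀ (c : OracleCode) {x y : ℕ}, y ∈ (c.toCode u).eval x → y ∈ c.eval O x := by
  intro c
  induction c with
  | zero => exact fun h => h
  | succ => exact fun h => h
  | left => exact fun h => h
  | right => exact fun h => h
  | oracle =>
    intro x y h
    rw [hu x y h]
    exact Part.mem_some _
  | pair cf cg hf hg =>
    intro x y h
    obtain ⟨a, ha, b, hb, rfl⟩ := mem_codeEval_pair.mp h
    exact mem_eval_pair.mpr ⟨a, hf ha, b, hg hb, rfl⟩
  | comp cf cg hf hg =>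
    intro x y h
    obtain ⟨a, ha, hb⟩ := mem_codeEval_comp.mp h
    exact mem_eval_comp.mpr ⟨a, hg ha, hf hb⟩
  | prec cf cg hf hg =>
    intro x y h
    simp only [toCode, Code.eval, eval, Nat.unpaired] at h ⊢
    generalize x.unpair.1 = a at h ⊢
    generalize x.unpair.2 = n at h ⊢
    induction n generalizing y with
    | zero => exact hf h
    | succ n ih =>
      simp only [Part.bind_eq_bind, Part.mem_bind_iff] at h ⊢
      obtain ⟨i, hi, h⟩ := h
      exact ⟨i, ih hi, hg h⟩
  | rfind' cf hf =>
    intro x y h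
    obtain ⟨a, ⟨h0, hlt⟩, rfl⟩ := mem_codeEval_rfind'.mp h
    refine mem_eval_rfind'.mpr ⟨a, ⟨hf h0, fun m hm => ?_⟩, rfl⟩
    obtain ⟨w, hw, hw0⟩ := hlt m hm
    exact ⟨w, hf hw, hw0⟩

theorem eventually_mem_eval_toCode {u : ℕ → Code} {O : ℕ → ℕ}
    (hu : ∀ n, ∀ᶠ k in atTop, O n ∈ (u k).eval n) :
    ∀ (c : OracleCode) {x y : ℕ}, y ∈ c.eval O x → ∀ᶠ k in atTop, y ∈ (c.toCode (u k)).eval x := by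
  intro c
  induction c with
  | zero => exact fun h => .of_forall fun _ => h
  | succ => exact fun h => .of_forall fun _ => h
  | left => exact fun h => .of_forall fun _ => h
  | right => exact fun h => .of_forall fun _ => h
  | oracle =>
    intro x y h
    obtain rfl : y = O x := Part.mem_some_iff.mp h
    exact hu x
  | pair cf cg hf hg =>
    intro x y h
    obtain ⟨a, ha, b, hb, rfl⟩ := mem_eval_pair.mp h
    filter_upwards [hf ha, hg hb] with k h1 h2
    exact mem_codeEval_pair.mpr ⟨a, h1, b, h2, rfl⟩
  | comp cf cg hf hg =>
    intro x y h
    obtain ⟨a, ha, hb⟩ := mem_eval_comp.mp h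
    filter_upwards [hg ha, hf hb] with k h1 h2
    exact mem_codeEval_comp.mpr ⟨a, h1, h2⟩
  | prec cf cg hf hg =>
    intro x y h
    simp only [toCode, Code.eval, eval, Nat.unpaired] at h ⊢
    generalize x.unpair.1 = a at h ⊢
    generalize x.unpair.2 = n at h ⊢
    induction n generalizing y with
    | zero => exact hf h
    | succ n ih =>
      simp only [Part.bind_eq_bind, Part.mem_bind_iff] at h ⊢
      obtain ⟨i, hi, h⟩ := h
      filter_upwards [ih hi, hg h] with k h1 h2
      exact ⟨i, h1, h2⟩
  | rfind' cf hf =>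
    intro x y h
    obtain ⟨a, ⟨h0, hlt⟩, rfl⟩ := mem_eval_rfind'.mp h
    have h2 : ∀ᶠ k in atTop, ∀ m ∈ Finset.range a, ∃ w ∈
        (cf.toCode (u k)).eval (Nat.pair x.unpair.1 (m + x.unpair.2)), w ≠ 0 := by
      rw [Filter.eventually_all_finset]
      intro m hm
      obtain ⟨w, hw, hw0⟩ := hlt m (Finset.mem_range.mp hm)
      filter_upwards [hf hw] with k hk
      exact ⟨w, hk, hw0⟩
    filter_upwards [hf h0, h2] with k h1 h2
    exact mem_codeEval_rfind'.mpr
      ⟨a, ⟨h1, fun m hm => h2 m (Finset.mem_range.mpr hm)⟩, rfl⟩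

theorem primrec_toCode_ofNum : Primrec₂ fun (u : Code) (e : ℕ) => (ofNum e).toCode u := by
  let g : Code → List Code → Option Code := fun u l =>
    if l.length = 0 then some .zero
    else if l.length = 1 then some .succ
    else if l.length = 2 then some .left
    else if l.length = 3 then some .right
    else if l.length = 4 then some u
    else
      (fun n : ℕ =>
        if n % 4 = 0 then some (.pair (l.getD (n / 4).unpair.1 .zero)
          (l.getD (n / 4).unpair.2 .zero))
        else if n % 4 = 1 then some (.comp (l.getD (n / 4).unpair.1 .zero)
          (l.getD (n / 4).unpair.2 .zero))
        else if n % 4 = 2 then some (.prec (l.getD (n / 4).unpair.1 .zero)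
          (l.getD (n / 4).unpair.2 .zero))
        else some (.rfind' (l.getD (n / 4) .zero))) (l.length - 5)
  have hl : Primrec fun p : Code × List Code => p.2.length := Primrec.list_length.comp Primrec.snd
  have hn : Primrec fun p : Code × List Code => p.2.length - 5 :=
    Primrec.nat_sub.comp hl (Primrec.const 5)
  have hq : Primrec fun p : Code × List Code => (p.2.length - 5) / 4 :=
    Primrec.nat_div.comp hn (Primrec.const 4)
  have hr : Primrec fun p : Code × List Code => (p.2.length - 5) % 4 :=
    Primrec.nat_mod.comp hn (Primrec.const 4)
  have h1 : Primrec fun p : Code × List Code =>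
      p.2.getD ((p.2.length - 5) / 4).unpair.1 .zero :=
    (Primrec.list_getD Code.zero).comp Primrec.snd (Primrec.fst.comp (Primrec.unpair.comp hq))
  have h2 : Primrec fun p : Code × List Code =>
      p.2.getD ((p.2.length - 5) / 4).unpair.2 .zero :=
    (Primrec.list_getD Code.zero).comp Primrec.snd (Primrec.snd.comp (Primrec.unpair.comp hq))
  have h3 : Primrec fun p : Code × List Code => p.2.getD ((p.2.length - 5) / 4) .zero :=
    (Primrec.list_getD Code.zero).comp Primrec.snd hq
  have hg : Primrec₂ g :=
    Primrec.ite (Primrec.eq.comp hl (Primrec.const 0)) (Primrec.const _) <|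
    Primrec.ite (Primrec.eq.comp hl (Primrec.const 1)) (Primrec.const _) <|
    Primrec.ite (Primrec.eq.comp hl (Primrec.const 2)) (Primrec.const _) <|
    Primrec.ite (Primrec.eq.comp hl (Primrec.const 3)) (Primrec.const _) <|
    Primrec.ite (Primrec.eq.comp hl (Primrec.const 4)) (Primrec.option_some.comp Primrec.fst) <|
    Primrec.ite (Primrec.eq.comp hr (Primrec.const 0))
      (Primrec.option_some.comp (Code.primrec₂_pair.comp h1 h2)) <|
    Primrec.ite (Primrec.eq.comp hr (Primrec.const 1))
      (Primrec.option_some.comp (Code.primrec₂_comp.comp h1 h2)) <|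
    Primrec.ite (Primrec.eq.comp hr (Primrec.const 2))
      (Primrec.option_some.comp (Code.primrec₂_prec.comp h1 h2))
      (Primrec.option_some.comp (Code.primrec_rfind'.comp h3))
  refine Primrec.nat_strong_rec _ hg fun u e => ?_
  match e with
  | 0 => simp [g, ofNum, toCode]
  | 1 => simp [g, ofNum, toCode]
  | 2 => simp [g, ofNum, toCode]
  | 3 => simp [g, ofNum, toCode]
  | 4 => simp [g, ofNum, toCode]
  | n + 5 =>
    have h1 : (n / 4).unpair.1 < n + 5 :=
      lt_of_le_of_lt ((Nat.unpair_left_le _).trans (Nat.div_le_self _ _)) (by omega)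
    have h2 : (n / 4).unpair.2 < n + 5 :=
      lt_of_le_of_lt ((Nat.unpair_right_le _).trans (Nat.div_le_self _ _)) (by omega)
    have h3 : n / 4 < n + 5 := lt_of_le_of_lt (Nat.div_le_self _ _) (by omega)
    rw [ofNum]
    simp only [g, List.length_map, List.length_range, List.getD_eq_getElem?_getD,
      List.getElem?_map, List.getElem?_range, h1, h2, h3, Nat.add_sub_cancel]
    split_ifs <;> first | omega | contradiction | simp [toCode]

/-- Every partial recursive code is an oracle code that ignores its oracle. -/
def ofCode : Code → OracleCode
  | .zero => zero
  | .succ => succ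
  | .left => left
  | .right => right
  | .pair cf cg => pair (ofCode cf) (ofCode cg)
  | .comp cf cg => comp (ofCode cf) (ofCode cg)
  | .prec cf cg => prec (ofCode cf) (ofCode cg)
  | .rfind' cf => rfind' (ofCode cf)

theorem eval_ofCode (O : ℕ → ℕ) (c : Code) : (ofCode c).eval O = c.eval := by
  induction c with
  | zero => rfl
  | succ => rfl
  | left => rfl
  | right => rfl
  | pair cf cg hf hg => simp only [ofCode, eval, Code.eval, hf, hg]; rfl
  | comp cf cg hf hg => simp only [ofCode, eval, Code.eval, hf, hg]; rfl
  | prec cf cg hf hg => simp only [ofCode, eval, Code.eval, hf, hg]; rfl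
  | rfind' cf hf => simp only [ofCode, eval, Code.eval, hf]; rfl

end OracleCode

/-! ### Computable enumerability relative to an oracle -/

/-- `p` is c.e. relative to `O`: it is witnessed by finite parts of `O` in a primitive recursive
way. -/
def CE {α : Type*} [Primcodable α] (O : ℕ → ℕ) (p : α → Prop) : Prop :=
  ∃ R : List ℕ → α → Prop, PrimrecPred (fun q : List ℕ × α => R q.1 q.2) ∧
    (∀ τ τ' x, τ <+: τ' → R τ x → R τ' x) ∧ ∀ x, p x ↔ ∃ k, R (pre O k) x

namespace CE

theorem exists_iff_eventually {α : Type*} {O : ℕ → ℕ} {R : List ℕ → α → Prop}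
    (hR : ∀ τ τ' x, τ <+: τ' → R τ x → R τ' x) (x : α) :
    (∃ k, R (pre O k) x) ↔ ∀ᶠ k in atTop, R (pre O k) x := by
  constructor
  · rintro ⟨k, hk⟩
    filter_upwards [eventually_ge_atTop k] with j hj
    exact hR _ _ _ (pre_prefix_pre O hj) hk
  · exact fun h => h.exists

variable {α β : Type*} [Primcodable α] [Primcodable β] {O : ℕ → ℕ}

theorem of_eq {p q : α → Prop} (hp : CE O p) (h : ∀ x, p x ↔ q x) : CE O q := by
  have : p = q := funext fun x => propext (h x)
  exact this ▸ hp

theorem of_primrecPred {p : α → Prop} (hp : PrimrecPred p) : CE O p :=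
  ⟨fun _ x => p x, hp.comp Primrec.snd, fun _ _ _ _ h => h, fun _ => ⟨fun h => ⟨0, h⟩, fun ⟨_, h⟩ => h⟩⟩

theorem eq_pre : CE O fun τ : List ℕ => τ = pre O τ.length := by
  refine ⟨fun τ' τ => τ'.take τ.length = τ, ?_, ?_, ?_⟩
  · exact Primrec.eq.comp (Primrec.list_take.comp (Primrec.list_length.comp Primrec.snd) Primrec.fst)
      Primrec.snd
  · intro τ τ' x h hx
    exact (List.prefix_iff_eq_take.mp ((List.prefix_iff_eq_take.mpr hx.symm).trans h)).symm
  · intro τ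
    constructor
    · intro h
      refine ⟨τ.length, ?_⟩
      change (pre O τ.length).take τ.length = τ
      rw [take_pre O le_rfl]
      exact h.symm
    · rintro ⟨k, hk⟩
      exact eq_pre_of_prefix O (List.prefix_iff_eq_take.mpr hk.symm)

theorem and {p q : α → Prop} (hp : CE O p) (hq : CE O q) : CE O fun x => p x ∧ q x := by
  obtain ⟨R, hR, hm, h⟩ := hp
  obtain ⟨S, hS, hm', h'⟩ := hq
  refine ⟨fun τ x => R τ x ∧ S τ x, hR.and hS, fun τ τ' x ht hx =>
    ⟨hm _ _ _ ht hx.1, hm' _ _ _ ht hx.2⟩, fun x => ?_⟩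
  rw [exists_iff_eventually (R := fun τ x => R τ x ∧ S τ x) (fun τ τ' x ht hx =>
    ⟨hm _ _ _ ht hx.1, hm' _ _ _ ht hx.2⟩)]
  change p x ∧ q x ↔ _
  rw [h, h', exists_iff_eventually hm,
    exists_iff_eventually hm', eventually_and]

theorem or {p q : α → Prop} (hp : CE O p) (hq : CE O q) : CE O fun x => p x ∨ q x := by
  obtain ⟨R, hR, hm, h⟩ := hp
  obtain ⟨S, hS, hm', h'⟩ := hq
  refine ⟨fun τ x => R τ x ∨ S τ x, hR.or hS, fun τ τ' x ht hx =>
    hx.imp (hm _ _ _ ht) (hm' _ _ _ ht), fun x => ?_⟩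
  change p x ∨ q x ↔ ∃ k, R (pre O k) x ∨ S (pre O k) x
  rw [h, h', exists_or]

theorem comp {p : β → Prop} (hp : CE O p) {f : α → β} (hf : Primrec f) :
    CE O fun x => p (f x) := by
  obtain ⟨R, hR, hm, h⟩ := hp
  exact ⟨fun τ x => R τ (f x), hR.comp (Primrec.pair Primrec.fst (hf.comp Primrec.snd)),
    fun τ τ' x => hm τ τ' (f x), fun x => h (f x)⟩

theorem exists' {p : α → β → Prop} (hp : CE O fun q : α × β => p q.1 q.2) :
    CE O fun x => ∃ y, p x y := by
  obtain ⟨R, hR, hm, h⟩ := hp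
  refine ⟨fun τ x => ∃ m < τ.length + 1, ∃ y ∈ (Encodable.decode m : Option β), R τ (x, y),
    ?_, ?_, ?_⟩
  · refine primrecPred_exists_lt (Primrec.succ.comp (Primrec.list_length.comp Primrec.fst)) ?_
    refine primrecPred_exists_mem_option (Primrec.decode.comp Primrec.snd) ?_
    exact hR.comp (Primrec.pair (Primrec.fst.comp (Primrec.fst.comp Primrec.fst))
      (Primrec.pair (Primrec.snd.comp (Primrec.fst.comp Primrec.fst)) Primrec.snd))
  · rintro τ τ' x ht ⟨m, hm', y, hy, h⟩
    exact ⟨m, lt_of_lt_of_le hm' (Nat.succ_le_succ ht.length_le), y, hy, hm _ _ _ ht h⟩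
  · intro x
    constructor
    · rintro ⟨y, hy⟩
      obtain ⟨k, hk⟩ := (h (x, y)).mp hy
      refine ⟨max k (Encodable.encode y), Encodable.encode y, ?_, y, by simp, ?_⟩
      · simp
      · exact hm _ _ _ (pre_prefix_pre O (le_max_left _ _)) hk
    · rintro ⟨k, _, _, y, _, hk⟩
      exact ⟨y, (h (x, y)).mpr ⟨k, hk⟩⟩

theorem forall_mem {p : α → β → Prop} (hp : CE O fun q : α × β => p q.1 q.2) {f : α → List β}
    (hf : Primrec f) : CE O fun x => ∀ y ∈ f x, p x y := by
  obtain ⟨R, hR, hm, h⟩ := hp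
  have hm' : ∀ τ τ' x, τ <+: τ' → (∀ y ∈ f x, R τ (x, y)) → ∀ y ∈ f x, R τ' (x, y) :=
    fun τ τ' x ht hx y hy => hm _ _ _ ht (hx y hy)
  refine ⟨fun τ x => ∀ y ∈ f x, R τ (x, y), ?_, hm', ?_⟩
  · refine primrecPred_forall_mem (hf.comp Primrec.snd) ?_
    exact hR.comp (Primrec.pair (Primrec.fst.comp Primrec.fst)
      (Primrec.pair (Primrec.snd.comp Primrec.fst) Primrec.snd))
  · intro x
    rw [exists_iff_eventually (R := fun τ x => ∀ y ∈ f x, R τ (x, y)) hm']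
    have h1 := Filter.eventually_all_finite (l := atTop) (f x).finite_toSet
      (p := fun y k => R (pre O k) (x, y))
    refine Iff.trans ?_ h1.symm
    refine forall₂_congr fun y _ => ?_
    rw [← exists_iff_eventually hm]
    exact h (x, y)

end CE

/-- The graph of the universal function with oracle `O` is c.e. in `O`. -/
theorem ce_mem_eval_ofNum (O : ℕ → ℕ) :
    CE O fun q : ℕ × ℕ × ℕ => q.2.2 ∈ (OracleCode.ofNum q.1).eval O q.2.1 := by
  have hlook : Partrec₂ fun (τ : List ℕ) (n : ℕ) => (τ[n]? : Part ℕ) :=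
    (Primrec.list_getElem?.to_comp : Computable₂ _).ofOption
  obtain ⟨u, hu⟩ := Code.exists_code.mp hlook
  have hu' : ∀ (τ : List ℕ) (n : ℕ),
      (Code.curry u (Encodable.encode τ)).eval n = (τ[n]? : Part ℕ) := by
    intro τ n
    rw [Code.eval_curry, hu]
    have : Nat.pair (Encodable.encode τ) n = Encodable.encode (τ, n) := rfl
    simp only [this, Encodable.encodek, Part.coe_some, Part.bind_some]
    exact Part.map_id' (fun _ => rfl) _
  have hprim : PrimrecPred fun r : (ℕ × ℕ × ℕ) × List ℕ × ℕ => Code.evaln r.2.2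
      ((OracleCode.ofNum r.1.1).toCode (Code.curry u (Encodable.encode r.2.1))) r.1.2.1 =
        some r.1.2.2 := by
    refine Primrec.eq.comp (Code.primrec_evaln.comp (Primrec.pair (Primrec.pair
      (Primrec.snd.comp Primrec.snd) (OracleCode.primrec_toCode_ofNum.comp
        (Code.primrec₂_curry.comp (Primrec.const u) (Primrec.encode.comp
          (Primrec.fst.comp Primrec.snd))) (Primrec.fst.comp Primrec.fst)))
      (Primrec.fst.comp (Primrec.snd.comp Primrec.fst)))) (Primrec.option_some.comp
        (Primrec.snd.comp (Primrec.snd.comp Primrec.fst)))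
  refine CE.of_eq (CE.exists' (β := List ℕ × ℕ) (p := fun q z => z.1 = pre O z.1.length ∧
    Code.evaln z.2 ((OracleCode.ofNum q.1).toCode (Code.curry u (Encodable.encode z.1))) q.2.1 =
        some q.2.2) ((CE.eq_pre.comp (Primrec.fst.comp Primrec.snd)).and
          (CE.of_primrecPred hprim))) ?_
  rintro ⟨e, x, y⟩
  constructor
  · rintro ⟨⟨τ, s⟩, hτ, h⟩
    refine OracleCode.mem_eval_of_mem_eval_toCode ?_ _
      (Code.evaln_sound (Option.mem_def.mpr h))
    intro n y hy
    rw [hu', hτ] at hy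
    have := Part.mem_ofOption.mp hy
    exact ((getElem?_pre_eq_some O).mp (Option.mem_def.mp this)).2.symm
  · intro h
    have h1 := OracleCode.eventually_mem_eval_toCode
      (u := fun k => Code.curry u (Encodable.encode (pre O k))) (O := O) (fun n => by
        filter_upwards [eventually_gt_atTop n] with k hk
        rw [hu', getElem?_pre O hk]
        exact Part.mem_some _) _ h
    obtain ⟨k, hk⟩ := h1.exists
    obtain ⟨s, hs⟩ := Code.evaln_complete.mp hk
    exact ⟨(pre O k, s), by simp, hs⟩

theorem ce_mem_eval (O : ℕ → ℕ) (c : OracleCode) :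
    CE O fun q : ℕ × ℕ => q.2 ∈ c.eval O q.1 :=
  ((ce_mem_eval_ofNum O).comp (Primrec.pair (Primrec.const c.encodeCode) Primrec.id)).of_eq
    fun q => by simp [OracleCode.ofNum_encodeCode]

theorem ce_jump (B : Set ℕ) : CE (chi B) fun e => e ∈ jump B := by
  refine (CE.exists' (p := fun e y => y ∈ (OracleCode.ofNum e).eval (chi B) e)
    ((ce_mem_eval_ofNum (chi B)).comp (f := fun q : ℕ × ℕ => (q.1, q.1, q.2))
      (Primrec.pair Primrec.fst (Primrec.pair Primrec.fst Primrec.snd)))).of_eq fun e => ?_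
  rw [← Part.dom_iff_mem]
  constructor
  · exact fun h => ⟨_, OracleCode.encodeCode_ofNum e, h⟩
  · rintro ⟨c, rfl, h⟩
    rwa [OracleCode.ofNum_encodeCode]

section Code

variable {α : Type*} [Primcodable α]

theorem ce_of_code {O : ℕ → ℕ} {p : α → Prop} (c : OracleCode)
    (h : ∀ x, p x ↔ (c.eval O (Encodable.encode x)).Dom) : CE O p :=
  (CE.exists' (p := fun x y => y ∈ c.eval O (Encodable.encode x))
    ((ce_mem_eval O c).comp (f := fun q : α × ℕ => (Encodable.encode q.1, q.2))
      (Primrec.pair (Primrec.encode.comp Primrec.fst) Primrec.snd))).of_eq fun x => by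
      rw [h, Part.dom_iff_mem]

/-- A code computing the reversal of the list of the first `k` values of the oracle. -/
theorem exists_code_reverse_pre : ∃ c : OracleCode, ∀ (O : ℕ → ℕ) (k : ℕ),
    c.eval O k = Part.some (Encodable.encode (pre O k).reverse) := by
  let step : OracleCode := .comp .succ (.pair (.comp .oracle (.comp .left .right))
    (.comp .right .right))
  have hstep : ∀ O a y i, step.eval O (Nat.pair a (Nat.pair y i)) =
      Part.some (Nat.succ (Nat.pair (O y) i)) := by
    intro O a y i
    refine Part.eq_some_iff.mpr ?_
    refine OracleCode.mem_eval_comp.mpr ⟨Nat.pair (O y) i, OracleCode.mem_eval_pair.mpr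
      ⟨O y, ?_, i, ?_, rfl⟩, Part.mem_some _⟩
    · refine OracleCode.mem_eval_comp.mpr ⟨y, OracleCode.mem_eval_comp.mpr ⟨Nat.pair y i, ?_, ?_⟩,
        Part.mem_some _⟩
      · exact Part.mem_some_iff.mpr (by simp)
      · exact Part.mem_some_iff.mpr (by simp)
    · refine OracleCode.mem_eval_comp.mpr ⟨Nat.pair y i, ?_, ?_⟩
      · exact Part.mem_some_iff.mpr (by simp)
      · exact Part.mem_some_iff.mpr (by simp)
  have hprec : ∀ O k, (OracleCode.prec .zero step).eval O (Nat.pair 0 k) =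
      Part.some (Encodable.encode (pre O k).reverse) := by
    intro O k
    simp only [OracleCode.eval, Nat.unpaired, Nat.unpair_pair]
    induction k with
    | zero => rfl
    | succ k ih =>
      simp only [ih]
      refine (Part.bind_some _ _).trans ?_
      rw [hstep, pre_succ, List.reverse_append]
      rfl
  refine ⟨.comp (.prec .zero step) (.pair .zero (.pair .left .right)), fun O k => ?_⟩
  refine Part.eq_some_iff.mpr (OracleCode.mem_eval_comp.mpr ⟨Nat.pair 0 k,
    OracleCode.mem_eval_pair.mpr ⟨0, Part.mem_some _, k, OracleCode.mem_eval_pair.mpr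
      ⟨k.unpair.1, Part.mem_some _, k.unpair.2, Part.mem_some _, Nat.pair_unpair k⟩, rfl⟩, ?_⟩)
  rw [hprec]
  exact Part.mem_some _

theorem CE.exists_code {O : ℕ → ℕ} {p : α → Prop} (hp : CE O p) :
    ∃ c : OracleCode, ∀ x, p x ↔ (c.eval O (Encodable.encode x)).Dom := by
  classical
  obtain ⟨R, hR, -, h⟩ := hp
  let q : ℕ → Prop := fun n => ∃ x ∈ (Encodable.decode n.unpair.1 : Option α),
    ∃ τ ∈ (Encodable.decode n.unpair.2 : Option (List ℕ)), R τ.reverse x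
  have hq : PrimrecPred q := by
    refine primrecPred_exists_mem_option
      (Primrec.decode.comp (Primrec.fst.comp Primrec.unpair)) ?_
    refine primrecPred_exists_mem_option
      (Primrec.decode.comp (Primrec.snd.comp (Primrec.unpair.comp Primrec.fst))) ?_
    exact hR.comp (Primrec.pair (Primrec.list_reverse.comp Primrec.snd)
      (Primrec.snd.comp Primrec.fst))
  have hf : Primrec fun n : ℕ => if q n then 0 else 1 :=
    Primrec.ite hq (Primrec.const 0) (Primrec.const 1)
  obtain ⟨d, hd⟩ := Code.exists_code.mp (Nat.Partrec.of_primrec (Primrec.nat_iff.mp hf))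
  obtain ⟨r, hr⟩ := exists_code_reverse_pre
  let cf : OracleCode := .comp (.ofCode d) (.pair .left (.comp r .right))
  have hcf : ∀ x k, cf.eval O (Nat.pair (Encodable.encode x) k) =
      Part.some (if R (pre O k) x then 0 else 1) := by
    intro x k
    refine Part.eq_some_iff.mpr (OracleCode.mem_eval_comp.mpr ⟨Nat.pair (Encodable.encode x)
      (Encodable.encode (pre O k).reverse), OracleCode.mem_eval_pair.mpr ⟨_, ?_, _,
        OracleCode.mem_eval_comp.mpr ⟨k, ?_, ?_⟩, rfl⟩, ?_⟩)
    · exact Part.mem_some_iff.mpr (by simp)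
    · exact Part.mem_some_iff.mpr (by simp)
    · rw [hr]; exact Part.mem_some _
    · rw [OracleCode.eval_ofCode, hd]
      refine Part.mem_some_iff.mpr ?_
      simp [q]
  refine ⟨.comp (.rfind' cf) (.pair (.pair .left .right) .zero), fun x => ?_⟩
  rw [h, Part.dom_iff_mem]
  have hcomp : ∀ y, y ∈ (OracleCode.comp (.rfind' cf) (.pair (.pair .left .right) .zero)).eval O
      (Encodable.encode x) ↔ y ∈ (OracleCode.rfind' cf).eval O
        (Nat.pair (Encodable.encode x) 0) := by
    intro y
    have : (OracleCode.pair (.pair .left .right) .zero).eval O (Encodable.encode x) =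
        Part.some (Nat.pair (Encodable.encode x) 0) :=
      Part.eq_some_iff.mpr (OracleCode.mem_eval_pair.mpr ⟨_, OracleCode.mem_eval_pair.mpr
        ⟨_, Part.mem_some _, _, Part.mem_some _, Nat.pair_unpair _⟩, 0, Part.mem_some _, rfl⟩)
    rw [OracleCode.mem_eval_comp, this]
    simp
  simp only [hcomp, OracleCode.mem_eval_rfind', Nat.unpair_pair, add_zero, hcf, Part.mem_some_iff]
  constructor
  · intro hk
    refine ⟨Nat.find hk, Nat.find hk, ⟨?_, fun m hm => ⟨_, rfl, ?_⟩⟩, rfl⟩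
    · simp [Nat.find_spec hk]
    · simp [Nat.find_min hk hm]
  · rintro ⟨_, k, ⟨hk, -⟩, -⟩
    refine ⟨k, ?_⟩
    by_contra hn
    simp [hn] at hk

end Code

theorem ceIn_iff {A : Set ℕ} {W : Set (List Bool)} : CeIn A W ↔ CE (chi A) fun σ => σ ∈ W :=
  ⟨fun ⟨c, hc⟩ => ce_of_code c hc, fun h => h.exists_code⟩

theorem ceSeqIn_iff {A : Set ℕ} {W : ℕ → Set (List Bool)} :
    CeSeqIn A W ↔ CE (chi A) fun q : ℕ × List Bool => q.2 ∈ W q.1 :=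
  ⟨fun ⟨c, hc⟩ => ce_of_code c fun q => hc q.1 q.2,
    fun h => h.exists_code.imp fun _ hc n σ => hc (n, σ)⟩

/-! ### The fair-coin measure -/

section Measure

/-- The sequences extending the string `σ`. -/
def cyl (σ : List Bool) : Set (ℕ → Bool) := {X | pre X σ.length = σ}

theorem mem_cyl {σ : List Bool} {X : ℕ → Bool} : X ∈ cyl σ ↔ pre X σ.length = σ := Iff.rfl

theorem mem_cyl_iff_getElem? {σ : List Bool} {X : ℕ → Bool} :
    X ∈ cyl σ ↔ ∀ i < σ.length, σ[i]? = some (X i) := by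
  rw [mem_cyl]
  constructor
  · intro h i hi
    rw [← h, getElem?_pre X hi]
  · intro h
    refine List.ext_getElem? fun i => ?_
    rcases lt_or_ge i σ.length with hi | hi
    · rw [h i hi, getElem?_pre X hi]
    · rw [List.getElem?_eq_none hi, List.getElem?_eq_none (by simpa using hi)]

theorem Cyl_eq_biUnion (W : Set (List Bool)) : Cyl W = ⋃ σ ∈ W, cyl σ := by
  ext X
  simp only [Cyl, Set.mem_ofPred_eq, Set.mem_iUnion, exists_prop]
  refine exists_congr fun σ => and_congr_right fun _ => ?_
  rw [mem_cyl_iff_getElem?]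
  constructor
  · intro h i hi
    rw [List.getElem?_eq_getElem hi, h ⟨i, hi⟩]
    rfl
  · intro h i
    have := h i i.2
    rw [List.getElem?_eq_getElem i.2] at this
    exact (Option.some_injective _ this).symm

theorem mem_Cyl {W : Set (List Bool)} {X : ℕ → Bool} : X ∈ Cyl W ↔ ∃ σ ∈ W, X ∈ cyl σ := by
  simp [Cyl_eq_biUnion]

theorem mem_Cyl_iff_pre {W : Set (List Bool)} {X : ℕ → Bool} : X ∈ Cyl W ↔ ∃ k, pre X k ∈ W := by
  rw [mem_Cyl]
  constructor
  · rintro ⟨σ, h, hX⟩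
    exact ⟨σ.length, by rwa [mem_cyl.mp hX]⟩
  · rintro ⟨k, h⟩
    exact ⟨_, h, by simp [mem_cyl]⟩

theorem isClopen_cyl (σ : List Bool) : IsClopen (cyl σ) := by
  have : cyl σ = ⋂ i ∈ Finset.range σ.length, (fun X : ℕ → Bool => X i) ⁻¹' {b | σ[i]? = some b} := by
    ext X
    simp [mem_cyl_iff_getElem?]
  rw [this]
  exact isClopen_biInter_finset fun i _ => (isClopen_discrete _).preimage (continuous_apply i)

theorem isOpen_Cyl (W : Set (List Bool)) : IsOpen (Cyl W) := by
  rw [Cyl_eq_biUnion]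
  exact isOpen_biUnion fun σ _ => (isClopen_cyl σ).isOpen

theorem measurableSet_cyl (σ : List Bool) : MeasurableSet (cyl σ) :=
  (isClopen_cyl σ).isOpen.measurableSet

theorem measurableSet_Cyl (W : Set (List Bool)) : MeasurableSet (Cyl W) :=
  (isOpen_Cyl W).measurableSet

/-- The binary expansion of a real number. -/
noncomputable def bits (x : ℝ) (n : ℕ) : Bool := decide (⌊x * 2 ^ (n + 1)⌋₊ % 2 = 1)

theorem mu_eq : mu = Measure.map bits (volume.restrict (Set.Ico (0 : ℝ) 1)) := rfl

theorem measurable_bits : Measurable bits := by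
  refine measurable_pi_iff.mpr fun n => ?_
  have h : Measurable fun x : ℝ => ⌊x * 2 ^ (n + 1)⌋₊ :=
    Nat.measurable_floor.comp (measurable_id.mul_const _)
  exact (measurable_from_nat (f := fun m => decide (m % 2 = 1))).comp h

instance : IsProbabilityMeasure mu := by
  rw [mu_eq]
  have : IsProbabilityMeasure (volume.restrict (Set.Ico (0 : ℝ) 1)) := ⟨by simp⟩
  exact Measure.isProbabilityMeasure_map measurable_bits.aemeasurable

/-- The natural number with binary digits `σ`, most significant first. -/
def binVal (σ : List Bool) : ℕ := σ.foldl (fun n b => 2 * n + b.toNat) 0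

theorem binVal_append (σ : List Bool) (b : Bool) : binVal (σ ++ [b]) = 2 * binVal σ + b.toNat := by
  simp [binVal]

theorem pre_bits_eq_iff {x : ℝ} (hx1 : x < 1) (σ : List Bool) :
    pre (bits x) σ.length = σ ↔ ⌊x * 2 ^ σ.length⌋₊ = binVal σ := by
  induction σ using List.reverseRecOn with
  | nil => simp [pre, binVal, hx1, Nat.floor_eq_zero]
  | append_singleton σ b ih =>
    have hdiv : ⌊x * 2 ^ (σ.length + 1)⌋₊ / 2 = ⌊x * 2 ^ σ.length⌋₊ := by
      have := Nat.floor_div_natCast (x * 2 ^ (σ.length + 1)) 2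
      rw [← this]
      congr 1
      push_cast
      rw [pow_succ]
      ring
    rw [List.length_append, List.length_singleton, pre_succ, binVal_append]
    have h1 : pre (bits x) σ.length ++ [bits x σ.length] = σ ++ [b] ↔
        pre (bits x) σ.length = σ ∧ bits x σ.length = b := by simp
    rw [h1, ih, ← hdiv, bits]
    cases b
    · simp only [decide_eq_false_iff_not, Bool.toNat_false]
      omega
    · simp only [decide_eq_true_eq, Bool.toNat_true]
      omega

theorem binVal_lt (σ : List Bool) : binVal σ < 2 ^ σ.length := by
  induction σ using List.reverseRecOn with
  | nil => simp [binVal]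
  | append_singleton σ b ih =>
    rw [binVal_append, List.length_append, List.length_singleton, pow_succ]
    have := Bool.toNat_le b
    omega

theorem mu_cyl (σ : List Bool) : mu (cyl σ) = 2⁻¹ ^ σ.length := by
  rw [mu_eq, Measure.map_apply measurable_bits (measurableSet_cyl σ), Measure.restrict_apply
    (measurable_bits (measurableSet_cyl σ))]
  have h2 : (0 : ℝ) < 2 ^ σ.length := by positivity
  have hv : (binVal σ : ℝ) + 1 ≤ 2 ^ σ.length := by exact_mod_cast binVal_lt σ
  have : bits ⁻¹' cyl σ ∩ Set.Ico 0 1 =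
      Set.Ico ((binVal σ : ℝ) / 2 ^ σ.length) ((binVal σ + 1) / 2 ^ σ.length) := by
    ext x
    simp only [Set.mem_inter_iff, Set.mem_preimage, Set.mem_Ico, mem_cyl]
    rw [div_le_iff₀ h2, lt_div_iff₀ h2]
    constructor
    · rintro ⟨h, hx, hx1⟩
      rw [pre_bits_eq_iff hx1] at h
      exact (Nat.floor_eq_iff (by positivity)).mp h
    · rintro ⟨h, h'⟩
      have hx : 0 ≤ x := by
        by_contra hx
        have : (0 : ℝ) ≤ binVal σ := by positivity
        nlinarith [mul_neg_of_neg_of_pos (not_le.mp hx) h2]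
      have hx1 : x < 1 := by nlinarith
      rw [pre_bits_eq_iff hx1]
      exact ⟨(Nat.floor_eq_iff (by positivity)).mpr ⟨h, h'⟩, hx, hx1⟩
  rw [this, Real.volume_Ico, ← sub_div, add_sub_cancel_left, one_div, ENNReal.ofReal_inv_of_pos h2,
    ENNReal.ofReal_pow zero_le_two, ENNReal.inv_pow]
  simp

theorem cyl_append_subset (σ τ : List Bool) : cyl (σ ++ τ) ⊆ cyl σ := by
  intro X hX
  refine (eq_pre_of_prefix X (k := (σ ++ τ).length) ?_).symm
  rw [mem_cyl.mp hX]
  exact List.prefix_append _ _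

theorem cyl_subset_of_prefix {σ τ : List Bool} (h : σ <+: τ) : cyl τ ⊆ cyl σ := by
  obtain ⟨ρ, rfl⟩ := h
  exact cyl_append_subset σ ρ

theorem prefix_of_mem_cyl {σ τ : List Bool} {X : ℕ → Bool} (hσ : X ∈ cyl σ) (hτ : X ∈ cyl τ)
    (h : σ.length ≤ τ.length) : σ <+: τ := by
  rw [← mem_cyl.mp hσ, ← mem_cyl.mp hτ]
  exact pre_prefix_pre X h

/-- A finite measure is determined by the measures of the basic clopen sets. -/
theorem eq_smul_mu {ν : Measure (ℕ → Bool)} {c : ENNReal} (hc : c ≠ ⊤)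
    (h : ∀ σ, ν (cyl σ) = c * 2⁻¹ ^ σ.length) : ν = c • mu := by
  have hu : ν Set.univ = c := by
    have := h []
    have h2 : cyl [] = Set.univ := by ext; simp [mem_cyl, pre]
    simpa [h2] using this
  have : IsFiniteMeasure ν := ⟨by rw [hu]; exact hc.lt_top⟩
  refine ext_of_generate_finite (Set.range cyl) ?_ ?_ ?_ ?_
  · refine le_antisymm ?_ ?_
    · refine iSup_le fun i => ?_
      rintro _ ⟨s, -, rfl⟩
      have : (fun X : ℕ → Bool => X i) ⁻¹' s =
          ⋃ σ ∈ {σ : List Bool | ∃ b ∈ s, σ[i]? = some b}, cyl σ := by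
        ext X
        simp only [Set.mem_preimage, Set.mem_iUnion, exists_prop]
        constructor
        · exact fun hX => ⟨pre X (i + 1), ⟨X i, hX, getElem?_pre X i.lt_succ_self⟩, by
            simp [mem_cyl]⟩
        · rintro ⟨σ, ⟨b, hb, hσ⟩, hX⟩
          rw [← mem_cyl.mp hX] at hσ
          rwa [← ((getElem?_pre_eq_some X).mp hσ).2] at hb
      rw [this]
      exact MeasurableSet.biUnion (Set.to_countable _) fun σ _ =>
        MeasurableSpace.measurableSet_generateFrom ⟨σ, rfl⟩
    · refine MeasurableSpace.generateFrom_le ?_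
      rintro _ ⟨σ, rfl⟩
      exact measurableSet_cyl σ
  · rintro _ ⟨σ, rfl⟩ _ ⟨τ, rfl⟩ ⟨X, hX, hY⟩
    rcases le_total σ.length τ.length with hl | hl
    · exact ⟨τ, (Set.inter_eq_right.mpr (cyl_subset_of_prefix (prefix_of_mem_cyl hX hY hl))).symm⟩
    · exact ⟨σ, (Set.inter_eq_left.mpr (cyl_subset_of_prefix (prefix_of_mem_cyl hY hX hl))).symm⟩
  · rintro _ ⟨σ, rfl⟩
    rw [h, Measure.smul_apply, mu_cyl, smul_eq_mul]
  · simp [hu]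

/-- Dropping the first `n` entries of a sequence. -/
def shift (n : ℕ) (X : ℕ → Bool) : ℕ → Bool := fun i => X (n + i)

theorem measurable_shift (n : ℕ) : Measurable (shift n) :=
  measurable_pi_iff.mpr fun i => measurable_pi_apply (n + i)

theorem mem_cyl_append {σ τ : List Bool} {X : ℕ → Bool} :
    X ∈ cyl (σ ++ τ) ↔ X ∈ cyl σ ∧ shift σ.length X ∈ cyl τ := by
  simp only [mem_cyl_iff_getElem?, List.length_append]
  constructor
  · intro h
    refine ⟨fun i hi => ?_, fun i hi => ?_⟩
    · rw [← h i (by omega), List.getElem?_append_left hi]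
    · rw [shift, ← h (σ.length + i) (by omega), List.getElem?_append_right (by omega),
        Nat.add_sub_cancel_left]
  · rintro ⟨h, h'⟩ i hi
    rcases lt_or_ge i σ.length with hl | hl
    · rw [List.getElem?_append_left hl, h i hl]
    · rw [List.getElem?_append_right hl, h' _ (by omega), shift, Nat.add_sub_cancel' hl]

theorem mu_cyl_inter_shift (σ : List Bool) {S : Set (ℕ → Bool)} (hS : MeasurableSet S) :
    mu (cyl σ ∩ shift σ.length ⁻¹' S) = 2⁻¹ ^ σ.length * mu S := by
  have h : (mu.restrict (cyl σ)).map (shift σ.length) = (2⁻¹ ^ σ.length : ENNReal) • mu := by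
    refine eq_smul_mu (by simp) fun τ => ?_
    rw [Measure.map_apply (measurable_shift _) (measurableSet_cyl τ),
      Measure.restrict_apply (measurable_shift _ (measurableSet_cyl τ)), ← pow_add,
      ← List.length_append, ← mu_cyl]
    congr 1
    ext X
    rw [mem_cyl_append, and_comm]
    rfl
  have := congrArg (fun ν => ν S) h
  simp only [Measure.map_apply (measurable_shift _) hS, Measure.smul_apply, smul_eq_mul] at this
  rw [← this, Measure.restrict_apply (measurable_shift _ hS), Set.inter_comm]

theorem mu_Cyl_eq {W : Set (List Bool)} (hW : ∀ σ ∈ W, ∀ τ ∈ W, σ <+: τ → σ = τ) :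
    mu (Cyl W) = ∑' σ : W, 2⁻¹ ^ σ.1.length := by
  rw [Cyl_eq_biUnion, measure_biUnion (Set.to_countable W) ?_ fun σ _ => measurableSet_cyl σ]
  · simp [mu_cyl]
  · intro σ hσ τ hτ hne
    refine Set.disjoint_left.mpr fun X hX hY => hne ?_
    rcases le_total σ.length τ.length with hl | hl
    · exact hW σ hσ τ hτ (prefix_of_mem_cyl hX hY hl)
    · exact (hW τ hτ σ hσ (prefix_of_mem_cyl hY hX hl)).symm

theorem mu_eq_infinitePi :
    mu = Measure.infinitePi fun _ : ℕ => (PMF.uniformOfFintype Bool).toMeasure := by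
  have h : ∀ σ, Measure.infinitePi (fun _ : ℕ => (PMF.uniformOfFintype Bool).toMeasure) (cyl σ) =
      1 * 2⁻¹ ^ σ.length := by
    intro σ
    have : cyl σ = Set.pi (Finset.range σ.length) fun i => {b : Bool | σ[i]? = some b} := by
      ext X
      simp [mem_cyl_iff_getElem?]
    rw [this, Measure.infinitePi_pi _ fun i _ => MeasurableSet.of_discrete, one_mul]
    rw [Finset.prod_congr rfl (g := fun _ => 2⁻¹), Finset.prod_const, Finset.card_range]
    intro i hi
    rw [Finset.mem_range] at hi
    have : {b : Bool | σ[i]? = some b} = {σ[i]} := by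
      ext b
      simp [List.getElem?_eq_getElem hi, eq_comm]
    rw [this, PMF.toMeasure_apply_singleton _ _ (measurableSet_singleton _)]
    simp
  rw [eq_smul_mu ENNReal.one_ne_top h, one_smul]

theorem mu_forall_eq_true (F : Finset ℕ) : mu {X | ∀ n ∈ F, X n = true} = 2⁻¹ ^ F.card := by
  have : {X : ℕ → Bool | ∀ n ∈ F, X n = true} = Set.pi F fun _ => {true} := by
    ext X
    simp
  rw [this, mu_eq_infinitePi, Measure.infinitePi_pi _ fun i _ => MeasurableSet.of_discrete]
  simp

theorem mu_pre_mem {n : ℕ} (G : Finset (List Bool)) (hG : ∀ σ ∈ G, σ.length = n) :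
    mu {X | pre X n ∈ G} = G.card * 2⁻¹ ^ n := by
  have : {X : ℕ → Bool | pre X n ∈ G} = Cyl G := by
    ext X
    rw [mem_Cyl]
    constructor
    · exact fun h => ⟨_, h, by simp [mem_cyl]⟩
    · rintro ⟨σ, hσ, hX⟩
      rw [mem_cyl, hG σ hσ] at hX
      change pre X n ∈ G
      rwa [hX]
  rw [this, mu_Cyl_eq]
  · rw [tsum_congr (g := fun _ => (2⁻¹ : ENNReal) ^ n) fun σ => by rw [hG σ.1 σ.2]]
    simp
  · intro σ hσ τ hτ h
    exact h.eq_of_length (by rw [hG σ hσ, hG τ hτ])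

end Measure

/-! ### Covering null sets from LR-reducibility -/

section LR

/-- The strings that decompose into `n` members of `W`. -/
def powStr (W : Set (List Bool)) (n : ℕ) : Set (List Bool) :=
  {ρ | ∃ L : List (List Bool), L.length = n ∧ (∀ σ ∈ L, σ ∈ W) ∧ L.flatten = ρ}

theorem append_mem_powStr {W : Set (List Bool)} {n : ℕ} {ρ σ : List Bool} (hρ : ρ ∈ powStr W n)
    (hσ : σ ∈ W) : ρ ++ σ ∈ powStr W (n + 1) := by
  obtain ⟨L, rfl, hL, rfl⟩ := hρ
  refine ⟨L ++ [σ], by simp, fun τ hτ => ?_, by simp⟩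
  rcases List.mem_append.mp hτ with h | h
  · exact hL τ h
  · rwa [List.mem_singleton.mp h]

theorem exists_of_mem_powStr_succ {W : Set (List Bool)} {n : ℕ} {ρ : List Bool}
    (h : ρ ∈ powStr W (n + 1)) : ∃ σ ∈ W, ∃ τ ∈ powStr W n, ρ = σ ++ τ := by
  obtain ⟨L, hn, hL, rfl⟩ := h
  cases L with
  | nil => simp at hn
  | cons σ L =>
    exact ⟨σ, hL σ (by simp), L.flatten, ⟨L, by simpa using hn, fun τ hτ => hL τ (by simp [hτ]),
      rfl⟩, by simp⟩

theorem exists_of_mem_powStr_succ' {W : Set (List Bool)} {n : ℕ} {ρ : List Bool}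
    (h : ρ ∈ powStr W (n + 1)) : ∃ τ ∈ powStr W n, τ <+: ρ := by
  obtain ⟨L, hn, hL, rfl⟩ := h
  refine ⟨(L.take n).flatten, ⟨L.take n, by simp [hn], fun τ hτ => hL τ (List.mem_of_mem_take hτ),
    rfl⟩, ?_⟩
  conv_rhs => rw [← List.take_append_drop n L, List.flatten_append]
  exact List.prefix_append _ _

theorem mu_Cyl_powStr_le {W : Set (List Bool)} (hW : ∑' σ : W, (2⁻¹ : ENNReal) ^ σ.1.length ≤ 2⁻¹)
    (n : ℕ) : mu (Cyl (powStr W n)) ≤ 2⁻¹ ^ n := by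
  induction n with
  | zero => simpa using prob_le_one
  | succ n ih =>
    have hsub : Cyl (powStr W (n + 1)) ⊆
        ⋃ σ ∈ W, cyl σ ∩ shift σ.length ⁻¹' Cyl (powStr W n) := by
      intro X hX
      obtain ⟨ρ, hρ, hX⟩ := mem_Cyl.mp hX
      obtain ⟨σ, hσ, τ, hτ, rfl⟩ := exists_of_mem_powStr_succ hρ
      rw [mem_cyl_append] at hX
      simp only [Set.mem_iUnion]
      exact ⟨σ, hσ, hX.1, mem_Cyl.mpr ⟨τ, hτ, hX.2⟩⟩
    refine (measure_mono hsub).trans ((measure_biUnion_le mu (Set.to_countable W) _).trans ?_)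
    simp only [mu_cyl_inter_shift _ (measurableSet_Cyl _)]
    rw [ENNReal.tsum_mul_right, pow_succ']
    exact mul_le_mul' hW ih

theorem mlTest_powStr {A : Set ℕ} {W : Set (List Bool)} (hWA : CE (chi A) fun σ => σ ∈ W)
    (hW : ∑' σ : W, (2⁻¹ : ENNReal) ^ σ.1.length ≤ 2⁻¹) :
    MLTest A fun n => Cyl (powStr W n) := by
  refine ⟨powStr W, ceSeqIn_iff.mpr ?_, fun _ => rfl, fun n => ?_, mu_Cyl_powStr_le hW⟩
  · refine CE.exists' (p := fun (q : ℕ × List Bool) (L : List (List Bool)) =>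
      L.length = q.1 ∧ (∀ σ ∈ L, σ ∈ W) ∧ L.flatten = q.2) ?_
    refine (CE.of_primrecPred ?_).and (CE.and ?_ (CE.of_primrecPred ?_))
    · exact Primrec.eq.comp (Primrec.list_length.comp Primrec.snd) (Primrec.fst.comp Primrec.fst)
    · exact CE.forall_mem (p := fun _ σ => σ ∈ W) (hWA.comp Primrec.snd) Primrec.snd
    · exact Primrec.eq.comp (Primrec.list_flatten.comp Primrec.snd) (Primrec.snd.comp Primrec.fst)
  · intro X hX
    obtain ⟨ρ, hρ, hX⟩ := mem_Cyl.mp hX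
    obtain ⟨τ, hτ, hpre⟩ := exists_of_mem_powStr_succ' hρ
    exact mem_Cyl.mpr ⟨τ, hτ, cyl_subset_of_prefix hpre hX⟩

/-- The strings `σ` such that `ρ ++ σ` extends a member of `V`. -/
def quot (V : Set (List Bool)) (ρ : List Bool) : Set (List Bool) := {σ | ∃ τ ∈ V, τ <+: ρ ++ σ}

theorem ce_quot {O : ℕ → ℕ} {V : Set (List Bool)} (hV : CE O fun σ => σ ∈ V) (ρ : List Bool) :
    CE O fun σ => σ ∈ quot V ρ := by
  refine CE.exists' (p := fun (σ τ : List Bool) => τ ∈ V ∧ τ <+: ρ ++ σ) ?_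
  refine (hV.comp Primrec.snd).and (CE.of_primrecPred ?_)
  have : PrimrecPred fun q : List Bool × List Bool => q.2 = (ρ ++ q.1).take q.2.length :=
    Primrec.eq.comp Primrec.snd (Primrec.list_take.comp (Primrec.list_length.comp Primrec.snd)
      (Primrec.list_append.comp (Primrec.const ρ) Primrec.fst))
  exact this.of_eq fun q => List.prefix_iff_eq_take.symm

theorem mem_Cyl_quot {V : Set (List Bool)} {ρ : List Bool} {X : ℕ → Bool} (hX : X ∈ cyl ρ) :
    shift ρ.length X ∈ Cyl (quot V ρ) ↔ X ∈ Cyl V := by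
  constructor
  · intro h
    obtain ⟨σ, ⟨τ, hτ, hpre⟩, h⟩ := mem_Cyl.mp h
    exact mem_Cyl.mpr ⟨τ, hτ, cyl_subset_of_prefix hpre (mem_cyl_append.mpr ⟨hX, h⟩)⟩
  · intro h
    obtain ⟨τ, hτ, h⟩ := mem_Cyl.mp h
    refine mem_Cyl.mpr ⟨pre (shift ρ.length X) τ.length, ⟨τ, hτ, ?_⟩, by simp [mem_cyl]⟩
    refine prefix_of_mem_cyl h (mem_cyl_append.mpr ⟨hX, ?_⟩) (by simp)
    simp [mem_cyl]

theorem cyl_diff_Cyl (V : Set (List Bool)) (ρ σ : List Bool) : cyl (ρ ++ σ) \ Cyl V =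
    cyl ρ ∩ shift ρ.length ⁻¹' (cyl σ \ Cyl (quot V ρ)) := by
  ext X
  simp only [Set.mem_sdiff, Set.mem_inter_iff, Set.mem_preimage, mem_cyl_append]
  constructor
  · rintro ⟨⟨h1, h2⟩, h3⟩
    exact ⟨h1, h2, by rwa [mem_Cyl_quot h1]⟩
  · rintro ⟨h1, h2, h3⟩
    exact ⟨⟨h1, h2⟩, by rwa [mem_Cyl_quot h1] at h3⟩

theorem mu_cyl_diff_Cyl (V : Set (List Bool)) (ρ σ : List Bool) :
    mu (cyl (ρ ++ σ) \ Cyl V) = 2⁻¹ ^ ρ.length * mu (cyl σ \ Cyl (quot V ρ)) := by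
  rw [cyl_diff_Cyl, mu_cyl_inter_shift _ ((measurableSet_cyl _).diff (measurableSet_Cyl _))]

theorem countable_mlTest (B : Set ℕ) : {U | MLTest B U}.Countable := by
  let Wc : ℕ → ℕ → Set (List Bool) := fun e n =>
    {σ | ((OracleCode.ofNum e).eval (chi B) (Nat.pair n (Encodable.encode σ))).Dom}
  refine (Set.countable_range fun e n => Cyl (Wc e n)).mono ?_
  rintro U ⟨W, ⟨c, hc⟩, hU, -⟩
  refine ⟨c.encodeCode, funext fun n => ?_⟩
  rw [hU]
  refine congrArg Cyl (Set.ext fun σ => ?_)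
  simp only [Wc, OracleCode.ofNum_encodeCode]
  exact (hc n σ).symm

theorem exists_mlTest (B : Set ℕ) : ∃ U, MLTest B U := by
  refine ⟨fun _ => ∅, fun _ => ∅, ceSeqIn_iff.mpr (CE.of_primrecPred ?_), fun n => ?_, by simp,
    by simp⟩
  · exact (Primrec.eq.comp (Primrec.const 0) (Primrec.const 1)).of_eq fun q => by simp
  · simp [Cyl]

/-- If `A ≤_LR B`, then a set of strings c.e. in `A` and of small weight is covered, up to a null
set, by a `Σ^B_1` class which is not of full measure. -/
theorem LRle.exists_cover {A B : Set ℕ} (hLR : LRle A B) {W : Set (List Bool)}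
    (hWA : CE (chi A) fun σ => σ ∈ W) (hW : ∑' σ : W, (2⁻¹ : ENNReal) ^ σ.1.length ≤ 2⁻¹) :
    ∃ V : Set (List Bool), CE (chi B) (fun σ => σ ∈ V) ∧ mu (Cyl V) < 1 ∧
      mu (Cyl W \ Cyl V) = 0 := by
  by_contra! hcon
  obtain ⟨U, hU⟩ := (countable_mlTest B).exists_eq_range (exists_mlTest B)
  have hUB : ∀ n, MLTest B (U n) := fun n => by
    have : U n ∈ {U | MLTest B U} := hU ▸ Set.mem_range_self n
    exact this
  let good : ℕ → List Bool × Set (List Bool) → Prop := fun n s => s.1 ∈ powStr W n ∧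
    CE (chi B) (fun σ => σ ∈ s.2) ∧ 0 < mu (cyl s.1 \ Cyl s.2)
  have step : ∀ n s, good n s → ∃ s', good (n + 1) s' ∧ s.1 <+: s'.1 ∧ s.2 ⊆ s'.2 ∧
      ∃ m, U n m ⊆ Cyl s'.2 := by
    rintro n ⟨ρ, V⟩ ⟨hρ, hV, hpos⟩
    obtain ⟨Wt, hce, hUW, -, hmu⟩ := hUB n
    obtain ⟨m, hm⟩ : ∃ m, mu (U n m) < mu (cyl ρ \ Cyl V) := by
      have ht : Tendsto (fun m => (2⁻¹ : ENNReal) ^ m) atTop (nhds 0) :=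
        ENNReal.tendsto_pow_atTop_nhds_zero_of_lt_one (ENNReal.inv_lt_one.mpr ENNReal.one_lt_two)
      obtain ⟨m, hm⟩ := (ht.eventually_lt_const hpos).exists
      exact ⟨m, (hmu m).trans_lt hm⟩
    have hV' : CE (chi B) fun σ => σ ∈ V ∪ Wt m :=
      hV.or ((ceSeqIn_iff.mp hce).comp (Primrec.pair (Primrec.const m) Primrec.id))
    have hpos' : 0 < mu (cyl ρ \ Cyl (V ∪ Wt m)) := by
      have : cyl ρ \ Cyl V ⊆ (cyl ρ \ Cyl (V ∪ Wt m)) ∪ U n m := by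
        intro X hX
        by_cases h : X ∈ U n m
        · exact Or.inr h
        · refine Or.inl ⟨hX.1, fun h' => ?_⟩
          obtain ⟨σ, hσ | hσ, hX'⟩ := mem_Cyl.mp h'
          · exact hX.2 (mem_Cyl.mpr ⟨σ, hσ, hX'⟩)
          · exact h (hUW m ▸ mem_Cyl.mpr ⟨σ, hσ, hX'⟩)
      by_contra h0
      have := (measure_mono (μ := mu) this).trans (measure_union_le _ _)
      rw [nonpos_iff_eq_zero.mp (not_lt.mp h0), zero_add] at this
      exact absurd this (not_le.mpr hm)
    set V' := V ∪ Wt m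
    have hlt : mu (Cyl (quot V' ρ)) < 1 := by
      refine lt_of_le_of_ne prob_le_one fun h1 => ?_
      have h2 := mu_cyl_diff_Cyl V' ρ []
      have h3 : mu (cyl [] \ Cyl (quot V' ρ)) = 0 :=
        measure_mono_null (fun X hX => hX.2) ((prob_compl_eq_zero_iff (measurableSet_Cyl _)).mpr h1)
      rw [List.append_nil, h3, mul_zero] at h2
      exact hpos'.ne' h2
    have hne := hcon _ (ce_quot hV' ρ) hlt
    obtain ⟨σ, hσ, hσpos⟩ : ∃ σ ∈ W, mu (cyl σ \ Cyl (quot V' ρ)) ≠ 0 := by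
      by_contra! hall
      refine hne ?_
      refine measure_mono_null (fun X hX => ?_)
        ((measure_biUnion_null_iff (Set.to_countable W)).mpr hall)
      obtain ⟨σ, hσ, h⟩ := mem_Cyl.mp hX.1
      exact Set.mem_biUnion hσ ⟨h, hX.2⟩
    refine ⟨(ρ ++ σ, V'), ⟨append_mem_powStr hρ hσ, hV', ?_⟩, List.prefix_append _ _,
      Set.subset_union_left, m, ?_⟩
    · rw [mu_cyl_diff_Cyl]
      exact ENNReal.mul_pos (by simp) hσpos
    · rw [hUW m]
      intro X hX
      obtain ⟨τ, hτ, h⟩ := mem_Cyl.mp hX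
      exact mem_Cyl.mpr ⟨τ, Or.inr hτ, h⟩
  choose! nxt hnxt using step
  let s : ℕ → List Bool × Set (List Bool) := fun n => Nat.rec ([], ∅) (fun n t => nxt n t) n
  have hs : ∀ n, good n (s n) := by
    intro n
    induction n with
    | zero =>
      refine ⟨⟨[], rfl, by simp, rfl⟩, CE.of_primrecPred ?_, ?_⟩
      · exact (Primrec.eq.comp (Primrec.const 0) (Primrec.const 1)).of_eq fun q => by simp [s]
      · have h1 : Cyl ∅ = ∅ := by simp [Cyl]
        simp [s, h1, mu_cyl]
    | succ n ih => exact (hnxt n _ ih).1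
  have hstep := fun n => (hnxt n (s n) (hs n)).2
  have hclosed : ∀ n, IsClosed (cyl (s n).1 \ Cyl (s n).2) := fun n =>
    (isClopen_cyl _).isClosed.sdiff (isOpen_Cyl _)
  obtain ⟨X, hX⟩ := IsCompact.nonempty_iInter_of_sequence_nonempty_isCompact_isClosed
    (fun n => cyl (s n).1 \ Cyl (s n).2) (fun n X hX => ⟨cyl_subset_of_prefix (hstep n).1 hX.1,
      fun h => by
        obtain ⟨τ, hτ, h⟩ := mem_Cyl.mp h
        exact hX.2 (mem_Cyl.mpr ⟨τ, (hstep n).2.1 hτ, h⟩)⟩)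
    (fun n => nonempty_of_measure_ne_zero (hs n).2.2.ne') (hclosed 0).isCompact hclosed
  rw [Set.mem_iInter] at hX
  have hXB : MLRandom B X := by
    intro T hT hXT
    obtain ⟨n, rfl⟩ : T ∈ Set.range U := hU ▸ hT
    obtain ⟨m, hm⟩ := (hstep n).2.2
    exact (hX (n + 1)).2 (hm (Set.mem_iInter.mp hXT m))
  exact hLR X hXB _ (mlTest_powStr hWA hW)
    (Set.mem_iInter.mpr fun n => mem_Cyl.mpr ⟨_, (hs n).1, (hX n).1⟩)

end LR

/-! ### Covering summable families -/

section Cover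

/-- All binary strings of length `n`. -/
def allStr (n : ℕ) : List (List Bool) :=
  Nat.rec [[]] (fun _ L => L.map (List.cons true) ++ L.map (List.cons false)) n

theorem mem_allStr {n : ℕ} {σ : List Bool} : σ ∈ allStr n ↔ σ.length = n := by
  induction n generalizing σ with
  | zero => simp [allStr, List.length_eq_zero_iff]
  | succ n ih =>
    have : allStr (n + 1) = (allStr n).map (List.cons true) ++ (allStr n).map (List.cons false) :=
      rfl
    rw [this]
    rcases σ with _ | ⟨b, σ⟩
    · simp
    · cases b <;> simp [ih]

theorem primrec_allStr : Primrec allStr := by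
  refine Primrec.nat_rec₁ (f := fun _ L => L.map (List.cons true) ++ L.map (List.cons false)) [[]]
    ?_
  have h : ∀ b : Bool, Primrec fun q : ℕ × List (List Bool) => q.2.map (List.cons b) := fun b =>
    Primrec.list_map Primrec.snd (Primrec.list_cons.comp (Primrec.const b) Primrec.snd)
  exact Primrec.list_append.comp (h true) (h false)

theorem primrec_two_pow : Primrec fun n : ℕ => 2 ^ n := by
  refine (Primrec.nat_rec₁ (f := fun _ m : ℕ => m * 2) 1
    (Primrec.nat_mul.comp Primrec.snd (Primrec.const 2))).of_eq fun n => ?_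
  induction n with
  | zero => rfl
  | succ n ih => rw [pow_succ, ← ih]

/-- A set of strings c.e. in `O` generates the same open set as a primitive recursive relation
monotone in both arguments. -/
theorem CE.exists_monotone {O : ℕ → ℕ} {W : Set (List Bool)} (hW : CE O fun σ => σ ∈ W) :
    ∃ D : List ℕ → List Bool → Prop, PrimrecPred (fun q : List ℕ × List Bool => D q.1 q.2) ∧
      (∀ τ τ' σ σ', τ <+: τ' → σ <+: σ' → D τ σ → D τ' σ') ∧
      ∀ X, X ∈ Cyl W ↔ ∃ n, D (pre O n) (pre X n) := by
  obtain ⟨R, hR, hm, h⟩ := hW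
  refine ⟨fun τ σ => ∃ j < σ.length + 1, R τ (σ.take j), ?_, ?_, fun X => ?_⟩
  · refine primrecPred_exists_lt (p := fun (q : List ℕ × List Bool) j => R q.1 (q.2.take j))
      (Primrec.succ.comp (Primrec.list_length.comp Primrec.snd)) ?_
    exact hR.comp (Primrec.pair (Primrec.fst.comp Primrec.fst)
      (Primrec.list_take.comp Primrec.snd (Primrec.snd.comp Primrec.fst)))
  · rintro τ τ' σ _ hτ ⟨ρ, rfl⟩ ⟨j, hj, hD⟩
    refine ⟨j, by rw [List.length_append]; omega, hm _ _ _ hτ ?_⟩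
    rwa [List.take_append_of_le_length (by omega)]
  · rw [mem_Cyl_iff_pre]
    constructor
    · rintro ⟨j, hj⟩
      obtain ⟨k, hk⟩ := (h _).mp hj
      refine ⟨max j k, j, by simp, ?_⟩
      rw [take_pre X (le_max_left _ _)]
      exact hm _ _ _ (pre_prefix_pre O (le_max_right _ _)) hk
    · rintro ⟨n, j, hj, hD⟩
      rw [length_pre] at hj
      rw [take_pre X (by omega)] at hD
      exact ⟨j, (h _).mpr ⟨n, hD⟩⟩

/-- The coordinates used for the `i`-th of the independent events. -/
def block (f : ℕ → ℕ) (i : ℕ) : Finset ℕ := (Finset.range (f i)).image (Nat.pair i)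

/-- Independent events with measures `2⁻¹ ^ f i`. -/
def blockEvent (f : ℕ → ℕ) (i : ℕ) : Set (ℕ → Bool) := {X | ∀ n ∈ block f i, X n = true}

variable {f : ℕ → ℕ}

theorem card_block (i : ℕ) : (block f i).card = f i := by
  rw [block, Finset.card_image_of_injective, Finset.card_range]
  intro a b h
  exact (Nat.pair_eq_pair.mp h).2

theorem mem_blockEvent {i : ℕ} {X : ℕ → Bool} :
    X ∈ blockEvent f i ↔ ∀ j < f i, X (Nat.pair i j) = true := by
  simp [blockEvent, block]

theorem mu_blockEvent (i : ℕ) : mu (blockEvent f i) = 2⁻¹ ^ f i := by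
  rw [blockEvent, mu_forall_eq_true, card_block]

theorem measurableSet_blockEvent (i : ℕ) : MeasurableSet (blockEvent f i) := by
  have : blockEvent f i = ⋂ n ∈ block f i, (fun X => X n) ⁻¹' {true} := by
    ext X
    simp [blockEvent]
  rw [this]
  exact Finset.measurableSet_biInter _ fun n _ =>
    measurable_pi_apply n (measurableSet_singleton true)

theorem mu_biInter_blockEvent (s : Finset ℕ) :
    mu (⋂ i ∈ s, blockEvent f i) = ∏ i ∈ s, mu (blockEvent f i) := by
  have : ⋂ i ∈ s, blockEvent f i = {X | ∀ n ∈ s.biUnion (block f), X n = true} := by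
    ext X
    simp only [blockEvent, Set.mem_iInter, Finset.mem_biUnion, Set.mem_ofPred_eq]
    exact ⟨fun h n ⟨i, hi, hn⟩ => h i hi n hn, fun h i hi n hn => h n ⟨i, hi, hn⟩⟩
  rw [this, mu_forall_eq_true, Finset.card_biUnion]
  · simp only [mu_blockEvent, card_block, Finset.prod_pow_eq_pow_sum]
  · intro i _ j _ hij
    refine Finset.disjoint_left.mpr fun n hn hn' => hij ?_
    simp only [block, Finset.mem_image] at hn hn'
    obtain ⟨a, -, rfl⟩ := hn
    obtain ⟨b, -, h⟩ := hn'
    exact (Nat.pair_eq_pair.mp h).1.symm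

/-- The second Borel-Cantelli lemma for the events `blockEvent f i`. -/
theorem tsum_ne_top_of_mu_iUnion_lt_one {J : Set ℕ} (hJ : mu (⋃ i ∈ J, blockEvent f i) < 1) :
    ∑' i : J, (2⁻¹ : ENNReal) ^ f i ≠ ⊤ := by
  classical
  intro htop
  let s : ℕ → Set (ℕ → Bool) := fun i => if i ∈ J then blockEvent f i else ∅
  have hsm : ∀ i, MeasurableSet (s i) := by
    intro i
    by_cases h : i ∈ J
    · simp [s, h, measurableSet_blockEvent]
    · simp [s, h]
  have hind : ProbabilityTheory.iIndepSet s mu := by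
    rw [ProbabilityTheory.iIndepSet_iff_meas_biInter hsm]
    intro t
    by_cases h : ∀ i ∈ t, i ∈ J
    · rw [Finset.prod_congr rfl (g := fun i => mu (blockEvent f i)) fun i hi => by simp [s, h i hi],
        ← mu_biInter_blockEvent]
      congr 1
      exact Set.iInter₂_congr fun i hi => by simp [s, h i hi]
    · push Not at h
      obtain ⟨i, hi, hiJ⟩ := h
      have hsi : s i = ∅ := by simp [s, hiJ]
      rw [Finset.prod_eq_zero hi (by simp [hsi])]
      refine measure_mono_null (Set.biInter_subset_of_mem hi) (by simp [hsi])
  have hsum : ∑' i, mu (s i) = ⊤ := by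
    rw [← htop, tsum_subtype J fun i => (2⁻¹ : ENNReal) ^ f i]
    refine tsum_congr fun i => ?_
    by_cases h : i ∈ J
    · simp [s, h, mu_blockEvent]
    · simp [s, h]
  refine hJ.not_ge ?_
  rw [← ProbabilityTheory.measure_limsup_eq_one hsm hind hsum]
  refine measure_mono (limsup_le_iSup.trans (Set.iUnion_subset fun i => ?_))
  by_cases h : i ∈ J
  · simp only [s, h, if_true]
    exact Set.subset_biUnion_of_mem (u := fun i => blockEvent f i) h
  · simp [s, h]

/-- The strings witnessing membership in `blockEvent f i`. -/
def blockStr (f : ℕ → ℕ) (i : ℕ) : Set (List Bool) :=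
  {ρ | ρ.length = Nat.pair i (f i) ∧ ∀ j < f i, ρ[Nat.pair i j]? = some true}

theorem Cyl_blockStr (i : ℕ) : Cyl (blockStr f i) = blockEvent f i := by
  ext X
  rw [mem_Cyl, mem_blockEvent]
  constructor
  · rintro ⟨ρ, ⟨-, hρ⟩, hX⟩ j hj
    have := hρ j hj
    rw [← mem_cyl.mp hX, getElem?_pre_eq_some] at this
    exact this.2
  · intro h
    refine ⟨pre X (Nat.pair i (f i)), ⟨length_pre _ _, fun j hj => ?_⟩, by simp [mem_cyl]⟩
    rw [getElem?_pre X (Nat.pair_lt_pair_right i hj), h j hj]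

theorem tsum_blockStr (i : ℕ) :
    ∑' ρ : blockStr f i, (2⁻¹ : ENNReal) ^ ρ.1.length = 2⁻¹ ^ f i := by
  rw [← mu_blockEvent, ← Cyl_blockStr, mu_Cyl_eq]
  exact fun σ hσ τ hτ h => h.eq_of_length (hσ.1.trans hτ.1.symm)

theorem ce_blockStr (hf : Primrec f) {O : ℕ → ℕ} {I : Set ℕ} (hI : CE O fun i => i ∈ I) :
    CE O fun ρ => ρ ∈ ⋃ i : I, blockStr f i := by
  refine CE.of_eq (CE.exists' (p := fun (ρ : List Bool) (i : ℕ) => i ∈ I ∧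
    (ρ.length = Nat.pair i (f i) ∧ ∀ j < f i, ρ[Nat.pair i j]? = some true))
    ((hI.comp Primrec.snd).and (CE.of_primrecPred (PrimrecPred.and ?_ ?_)))) fun ρ => ?_
  · exact Primrec.eq.comp (Primrec.list_length.comp Primrec.fst)
      (Primrec₂.natPair.comp Primrec.snd (hf.comp Primrec.snd))
  · refine primrecPred_forall_lt (p := fun (q : List Bool × ℕ) j =>
      q.1[Nat.pair q.2 j]? = some true) (hf.comp Primrec.snd) ?_
    exact Primrec.eq.comp (Primrec.list_getElem?.comp (Primrec.fst.comp Primrec.fst)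
      (Primrec₂.natPair.comp (Primrec.snd.comp Primrec.fst) Primrec.snd)) (Primrec.const _)
  · simp only [blockStr, Set.mem_iUnion, Subtype.exists, exists_prop, Set.mem_ofPred_eq]

/-- If `A ≤_LR B`, then a set c.e. in `A` of small weight is contained in a set c.e. in `B` of
finite weight. -/
theorem LRle.exists_superset {A B : Set ℕ} (hLR : LRle A B) (hf : Primrec f) {I : Set ℕ}
    (hIA : CE (chi A) fun i => i ∈ I) (hI : ∑' i : I, (2⁻¹ : ENNReal) ^ f i ≤ 2⁻¹) :
    ∃ J : Set ℕ, CE (chi B) (fun i => i ∈ J) ∧ I ⊆ J ∧ ∑' i : J, (2⁻¹ : ENNReal) ^ f i ≠ ⊤ := by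
  classical
  obtain ⟨V, hVB, hV1, hIV⟩ := hLR.exists_cover (ce_blockStr hf hIA) (by
    refine (ENNReal.tsum_iUnion_le_tsum (fun ρ => (2⁻¹ : ENNReal) ^ ρ.length)
      fun i : I => blockStr f i).trans (le_trans (le_of_eq ?_) hI)
    exact tsum_congr fun i => tsum_blockStr i.1)
  obtain ⟨D, hD, hDm, hVD⟩ := hVB.exists_monotone
  obtain ⟨c, hc⟩ : ∃ c : ℕ, (2⁻¹ : ENNReal) ^ c < mu (Cyl V)ᶜ := by
    have ht : Tendsto (fun m => (2⁻¹ : ENNReal) ^ m) atTop (nhds 0) :=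
      ENNReal.tendsto_pow_atTop_nhds_zero_of_lt_one (ENNReal.inv_lt_one.mpr ENNReal.one_lt_two)
    refine (ht.eventually_lt_const (pos_iff_ne_zero.mpr fun h => ?_)).exists
    exact hV1.ne ((prob_compl_eq_zero_iff (measurableSet_Cyl V)).mp h)
  let good : ℕ → List ℕ → List (List Bool) → Prop := fun i τ L =>
    (∀ ρ ∈ allStr τ.length, (D τ ρ ∨ ∃ j < f i, ρ[Nat.pair i j]? = some false) ∨
      ∃ ρ' ∈ L, ρ' = ρ) ∧ L.length * 2 ^ (i + 1 + c) ≤ 2 ^ τ.length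
  let J : Set ℕ := {i | ∃ q : List ℕ × List (List Bool), q.1 = pre (chi B) q.1.length ∧
    good i q.1 q.2}
  have hJB : CE (chi B) fun i => i ∈ J := by
    refine CE.exists' (p := fun (i : ℕ) (q : List ℕ × List (List Bool)) =>
      q.1 = pre (chi B) q.1.length ∧ good i q.1 q.2) ?_
    refine (CE.eq_pre.comp (Primrec.fst.comp Primrec.snd)).and
      (CE.of_primrecPred (PrimrecPred.and ?_ ?_))
    · refine primrecPred_forall_mem (p := fun (x : ℕ × List ℕ × List (List Bool)) ρ =>
        (D x.2.1 ρ ∨ ∃ j < f x.1, ρ[Nat.pair x.1 j]? = some false) ∨ ∃ ρ' ∈ x.2.2, ρ' = ρ)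
        (primrec_allStr.comp (Primrec.list_length.comp (Primrec.fst.comp Primrec.snd)))
        (PrimrecPred.or (PrimrecPred.or ?_ ?_) ?_)
      · exact hD.comp (Primrec.pair (Primrec.fst.comp (Primrec.snd.comp Primrec.fst)) Primrec.snd)
      · refine primrecPred_exists_lt (p := fun (y : (ℕ × List ℕ × List (List Bool)) × List Bool)
          j => y.2[Nat.pair y.1.1 j]? = some false) (hf.comp (Primrec.fst.comp Primrec.fst)) ?_
        exact Primrec.eq.comp (Primrec.list_getElem?.comp (Primrec.snd.comp Primrec.fst)
          (Primrec₂.natPair.comp (Primrec.fst.comp (Primrec.fst.comp Primrec.fst)) Primrec.snd))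
          (Primrec.const _)
      · refine primrecPred_exists_mem (p := fun (y : (ℕ × List ℕ × List (List Bool)) × List Bool)
          ρ' => ρ' = y.2) (Primrec.snd.comp (Primrec.snd.comp Primrec.fst)) ?_
        exact Primrec.eq.comp Primrec.snd (Primrec.snd.comp Primrec.fst)
    · exact Primrec.nat_le.comp (Primrec.nat_mul.comp
        (Primrec.list_length.comp (Primrec.snd.comp Primrec.snd)) (primrec_two_pow.comp
          (Primrec.nat_add.comp (Primrec.succ.comp Primrec.fst) (Primrec.const c))))
        (primrec_two_pow.comp (Primrec.list_length.comp (Primrec.fst.comp Primrec.snd)))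
  have two_pow_mul : ∀ n : ℕ, (2 : ENNReal) ^ n * 2⁻¹ ^ n = 1 := fun n => by
    rw [← mul_pow, ENNReal.mul_inv_cancel two_ne_zero ENNReal.ofNat_ne_top, one_pow]
  have hcount : ∀ N n m : ℕ, N * 2 ^ m ≤ 2 ^ n ↔ (N : ENNReal) * 2⁻¹ ^ n ≤ 2⁻¹ ^ m := by
    intro N n m
    rw [← Nat.cast_le (α := ENNReal)]
    push_cast
    constructor
    · intro h
      calc (N : ENNReal) * 2⁻¹ ^ n = N * 2 ^ m * (2⁻¹ ^ n * 2⁻¹ ^ m) := by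
            rw [mul_assoc, mul_left_comm (2 ^ m), two_pow_mul, mul_one]
        _ ≤ 2 ^ n * (2⁻¹ ^ n * 2⁻¹ ^ m) := by gcongr
        _ = 2⁻¹ ^ m := by rw [← mul_assoc, two_pow_mul, one_mul]
    · intro h
      calc (N : ENNReal) * 2 ^ m = N * 2⁻¹ ^ n * (2 ^ n * 2 ^ m) := by
            rw [mul_assoc, ← mul_assoc (2⁻¹ ^ n), mul_comm (2⁻¹ ^ n), two_pow_mul, one_mul]
        _ ≤ 2⁻¹ ^ m * (2 ^ n * 2 ^ m) := by gcongr
        _ = 2 ^ n := by rw [mul_left_comm, mul_comm (2⁻¹ ^ m), two_pow_mul, mul_one]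
  have hIJ : I ⊆ J := by
    intro i hi
    let E : ℕ → Finset (List Bool) := fun n => (allStr n).toFinset.filter fun ρ =>
      ¬ (D (pre (chi B) n) ρ ∨ ∃ j < f i, ρ[Nat.pair i j]? = some false)
    let T : ℕ → Set (ℕ → Bool) := fun n => {X | pre X n ∈ E n}
    have hElen : ∀ n, ∀ σ ∈ E n, σ.length = n := fun n σ hσ =>
      mem_allStr.mp (List.mem_toFinset.mp (Finset.mem_filter.mp hσ).1)
    have hT : ∀ n X, X ∈ T n ↔ ¬ (D (pre (chi B) n) (pre X n) ∨
        ∃ j < f i, (pre X n)[Nat.pair i j]? = some false) := by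
      intro n X
      simp only [T, E, Set.mem_ofPred_eq, Finset.mem_filter, List.mem_toFinset, mem_allStr,
        length_pre, true_and]
    have hTm : ∀ n, MeasurableSet (T n) := fun n => by
      have : T n = ⋃ σ ∈ E n, cyl σ := by
        ext X
        simp only [T, Set.mem_ofPred_eq, Set.mem_iUnion, exists_prop]
        constructor
        · exact fun h => ⟨_, h, by simp [mem_cyl]⟩
        · rintro ⟨σ, hσ, hX⟩
          rw [mem_cyl, hElen n σ hσ] at hX
          rwa [hX]
      rw [this]
      exact Finset.measurableSet_biUnion _ fun σ _ => measurableSet_cyl σ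
    have hanti : Antitone T := by
      intro m n hmn X hX
      rw [hT] at hX ⊢
      refine fun h => hX (h.imp (hDm _ _ _ _ (pre_prefix_pre _ hmn) (pre_prefix_pre _ hmn)) ?_)
      rintro ⟨j, hj, h⟩
      refine ⟨j, hj, ?_⟩
      rw [getElem?_pre_eq_some] at h ⊢
      exact ⟨h.1.trans_le hmn, h.2⟩
    have hinter : ⋂ n, T n ⊆ Cyl (⋃ i : I, blockStr f i) \ Cyl V := by
      intro X hX
      simp only [Set.mem_iInter, hT, not_or] at hX
      refine ⟨?_, fun h => ?_⟩
      · have : X ∈ Cyl (blockStr f i) := by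
          rw [Cyl_blockStr, mem_blockEvent]
          intro j hj
          by_contra hne
          refine (hX (Nat.pair i j + 1)).2 ⟨j, hj, ?_⟩
          rw [getElem?_pre X (Nat.lt_succ_self _)]
          simpa using hne
        obtain ⟨σ, hσ, h⟩ := mem_Cyl.mp this
        exact mem_Cyl.mpr ⟨σ, Set.mem_iUnion.mpr ⟨⟨i, hi⟩, hσ⟩, h⟩
      · obtain ⟨n, hn⟩ := (hVD X).mp h
        exact (hX n).1 hn
    have hlim := tendsto_measure_iInter_atTop (μ := mu) (fun n => (hTm n).nullMeasurableSet) hanti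
      ⟨0, measure_ne_top _ _⟩
    rw [measure_mono_null hinter hIV] at hlim
    obtain ⟨n, hn⟩ := (hlim.eventually_le_const
      (show (0 : ENNReal) < 2⁻¹ ^ (i + 1 + c) from ENNReal.pow_pos (by simp) _)).exists
    refine ⟨(pre (chi B) n, (E n).toList), by simp, fun ρ hρ => ?_, ?_⟩
    · by_cases h : D (pre (chi B) n) ρ ∨ ∃ j < f i, ρ[Nat.pair i j]? = some false
      · exact Or.inl h
      · refine Or.inr ⟨ρ, ?_, rfl⟩
        rw [length_pre] at hρ
        simp only [Finset.mem_toList, E, Finset.mem_filter, List.mem_toFinset]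
        exact ⟨hρ, h⟩
    · rw [hcount, length_pre, Finset.length_toList]
      refine le_trans (le_of_eq ?_) hn
      exact (mu_pre_mem (E n) (hElen n)).symm
  refine ⟨J, hJB, hIJ, tsum_ne_top_of_mu_iUnion_lt_one ?_⟩
  have hsmall : ∀ i ∈ J, mu (blockEvent f i \ Cyl V) ≤ 2⁻¹ ^ (i + 1 + c) := by
    rintro i ⟨⟨τ, L⟩, hτ, hL, hcard⟩
    rw [hcount] at hcard
    dsimp only at hτ hL hcard
    have : blockEvent f i \ Cyl V ⊆
        {X | pre X τ.length ∈ L.toFinset.filter fun ρ => ρ.length = τ.length} := by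
      intro X hX
      rw [Set.mem_ofPred_eq, Finset.mem_filter, List.mem_toFinset]
      refine ⟨?_, length_pre _ _⟩
      rcases hL (pre X τ.length) (mem_allStr.mpr (length_pre _ _)) with (h | ⟨j, hj, h⟩) | ⟨ρ, h, rfl⟩
      · rw [hτ, length_pre] at h
        exact absurd ((hVD X).mpr ⟨_, h⟩) hX.2
      · rw [getElem?_pre_eq_some, mem_blockEvent.mp hX.1 j hj] at h
        simp at h
      · exact h
    refine (measure_mono this).trans ?_
    rw [mu_pre_mem _ fun σ hσ => (Finset.mem_filter.mp hσ).2]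
    refine le_trans ?_ hcard
    gcongr
    exact (Finset.card_filter_le _ _).trans (List.toFinset_card_le _)
  have hU : mu ((⋃ i ∈ J, blockEvent f i) \ Cyl V) ≤ 2⁻¹ ^ c := by
    have hsub : (⋃ i ∈ J, blockEvent f i) \ Cyl V ⊆ ⋃ i ∈ J, blockEvent f i \ Cyl V := by
      rintro X ⟨hX, hXV⟩
      simp only [Set.mem_iUnion] at hX ⊢
      obtain ⟨i, hi, h⟩ := hX
      exact ⟨i, hi, h, hXV⟩
    calc mu ((⋃ i ∈ J, blockEvent f i) \ Cyl V) ≤ mu (⋃ i ∈ J, blockEvent f i \ Cyl V) :=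
          measure_mono hsub
      _ ≤ ∑' i : J, mu (blockEvent f i \ Cyl V) := measure_biUnion_le mu (Set.to_countable J) _
      _ ≤ ∑' i : J, 2⁻¹ ^ (i.1 + 1 + c) := ENNReal.tsum_le_tsum fun i => hsmall i.1 i.2
      _ ≤ ∑' i : ℕ, 2⁻¹ ^ (i + 1 + c) :=
          ENNReal.tsum_comp_le_tsum_of_injective Subtype.val_injective _
      _ = 2⁻¹ ^ c := by
          simp only [pow_add _ _ c]
          rw [ENNReal.tsum_mul_right, ENNReal.tsum_geometric_add_one]
          rw [ENNReal.one_sub_inv_two, inv_inv, ENNReal.inv_mul_cancel two_ne_zero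
            ENNReal.ofNat_ne_top, one_mul]
  refine lt_of_le_of_ne prob_le_one fun h1 => ?_
  have hmeas : MeasurableSet (⋃ i ∈ J, blockEvent f i) :=
    MeasurableSet.biUnion (Set.to_countable J) fun i _ => measurableSet_blockEvent i
  have h2 := (prob_compl_eq_zero_iff hmeas).mpr h1
  have h3 : (Cyl V)ᶜ ⊆ ((⋃ i ∈ J, blockEvent f i) \ Cyl V) ∪ (⋃ i ∈ J, blockEvent f i)ᶜ := by
    intro X hX
    by_cases h : X ∈ ⋃ i ∈ J, blockEvent f i
    · exact Or.inl ⟨h, hX⟩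
    · exact Or.inr h
  have h4 := (measure_mono (μ := mu) h3).trans (measure_union_le _ _)
  rw [h2, add_zero] at h4
  exact hc.not_ge (h4.trans hU)

end Cover

/-! ### Approximating sets computable from the jump -/

section Limit

theorem exists_jump_approx (B : Set ℕ) : ∃ b : List ℕ → List ℕ, Primrec b ∧
    ∀ k, ∀ᶠ v in atTop, (b (pre (chi B) v)).take k = pre (chi (jump B)) k := by
  classical
  obtain ⟨R, hR, hm, h⟩ := ce_jump B
  refine ⟨fun β => pre (fun e => if R β e then 1 else 0) β.length, ?_, fun k => ?_⟩
  · exact Primrec.list_map (Primrec.list_range.comp Primrec.list_length)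
      (Primrec.ite hR (Primrec.const 1) (Primrec.const 0))
  · have hev : ∀ e, ∀ᶠ v in atTop, (if R (pre (chi B) v) e then 1 else 0) = chi (jump B) e := by
      intro e
      by_cases he : e ∈ jump B
      · filter_upwards [(CE.exists_iff_eventually hm e).mp ((h e).mp he)] with v hv
        rw [if_pos hv]
        simp [chi, he]
      · refine Eventually.of_forall fun v => ?_
        rw [if_neg fun hv => he ((h e).mpr ⟨v, hv⟩)]
        simp [chi, he]
    filter_upwards [(eventually_all_finite (Set.finite_lt_nat k)).mpr fun e _ => hev e,
      eventually_ge_atTop k] with v hv hk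
    rw [take_pre _ (by simpa using hk)]
    exact List.map_congr_left fun e he => hv e (List.mem_range.mp he)

theorem chi_eq_zero_or_one (A : Set ℕ) (j : ℕ) : chi A j = 0 ∨ chi A j = 1 := by
  by_cases h : j ∈ A <;> simp [chi, h]

/-- If `A ≤_T B'`, then the values of `chi A` can be guessed in the limit from finite parts of
`B`. -/
theorem TuringLE.exists_approx {A B : Set ℕ} (hT : TuringLE A (jump B)) :
    ∃ E : List ℕ → ℕ × ℕ → Prop, PrimrecPred (fun q : List ℕ × ℕ × ℕ => E q.1 q.2) ∧
      (∀ j, ∀ᶠ v in atTop, E (pre (chi B) v) (j, chi A j)) ∧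
      ∀ j y, y ≠ chi A j → ∀ᶠ v in atTop, ¬ E (pre (chi B) v) (j, y) := by
  obtain ⟨c, hc⟩ := hT
  obtain ⟨b, hb, hblim⟩ := exists_jump_approx B
  obtain ⟨R, hR, -, h⟩ := ce_mem_eval (chi (jump B)) c
  have hgraph : ∀ j y, y = chi A j ↔ ∃ k, R (pre (chi (jump B)) k) (j, y) := by
    intro j y
    rw [← h (j, y), hc]
    exact Part.mem_some_iff.symm
  let N : List ℕ → ℕ × ℕ → Prop := fun τ x => (R τ (x.1, 0) ∧ ¬ x.2 = 0) ∨ (R τ (x.1, 1) ∧ ¬ x.2 = 1)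
  have hN : PrimrecPred fun q : List ℕ × ℕ × ℕ => N q.1 q.2 := by
    have key : ∀ a : ℕ, PrimrecPred fun q : List ℕ × ℕ × ℕ => R q.1 (q.2.1, a) ∧ ¬ q.2.2 = a :=
      fun a => (hR.comp (Primrec.pair Primrec.fst (Primrec.pair (Primrec.fst.comp Primrec.snd)
        (Primrec.const a)))).and
        (Primrec.eq.comp (Primrec.snd.comp Primrec.snd) (Primrec.const a)).not
    exact (key 0).or (key 1)
  have hNgraph : ∀ j y, y ≠ chi A j ↔ ∃ k, N (pre (chi (jump B)) k) (j, y) := by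
    intro j y
    simp only [N, exists_or, exists_and_right, ← hgraph]
    rcases chi_eq_zero_or_one A j with h0 | h0 <;> simp [h0]
  refine ⟨fun β x => ∃ k < β.length + 1, R ((b β).take k) x ∧ ∀ k' < k + 1, ¬ N ((b β).take k') x,
    ?_, fun j => ?_, fun j y hy => ?_⟩
  · refine primrecPred_exists_lt (p := fun (q : List ℕ × ℕ × ℕ) k => R ((b q.1).take k) q.2 ∧
      ∀ k' < k + 1, ¬ N ((b q.1).take k') q.2)
      (Primrec.succ.comp (Primrec.list_length.comp Primrec.fst)) (PrimrecPred.and ?_ ?_)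
    · exact hR.comp (Primrec.pair (Primrec.list_take.comp Primrec.snd
        (hb.comp (Primrec.fst.comp Primrec.fst))) (Primrec.snd.comp Primrec.fst))
    · refine primrecPred_forall_lt (p := fun (r : (List ℕ × ℕ × ℕ) × ℕ) k' =>
        ¬ N ((b r.1.1).take k') r.1.2) (Primrec.succ.comp Primrec.snd) (PrimrecPred.not ?_)
      exact hN.comp (Primrec.pair (Primrec.list_take.comp Primrec.snd
        (hb.comp (Primrec.fst.comp (Primrec.fst.comp Primrec.fst))))
        (Primrec.snd.comp (Primrec.fst.comp Primrec.fst)))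
  · obtain ⟨k, hk⟩ := (hgraph j _).mp rfl
    filter_upwards [eventually_ge_atTop k,
      (eventually_all_finite (Set.finite_lt_nat (k + 1))).mpr fun k' _ => hblim k'] with v hv hlim
    refine ⟨k, by rw [length_pre]; omega, ?_, fun k' hk' => ?_⟩
    · rwa [hlim k (Nat.lt_succ_self k)]
    · rw [hlim k' hk']
      exact fun h' => (hNgraph j _).mpr ⟨k', h'⟩ rfl
  · obtain ⟨k₁, hk₁⟩ := (hNgraph j y).mp hy
    filter_upwards [(eventually_all_finite (Set.finite_lt_nat (k₁ + 1))).mpr fun k' _ => hblim k']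
      with v hlim
    rintro ⟨k, -, hRk, hNk⟩
    rcases lt_or_ge k k₁ with hlt | hge
    · rw [hlim k (Nat.lt_succ_of_lt hlt)] at hRk
      exact hy ((hgraph j y).mpr ⟨k, hRk⟩)
    · refine hNk k₁ (Nat.lt_succ_of_le hge) ?_
      rwa [hlim k₁ (Nat.lt_succ_self k₁)]

/-- If `A ≤_T B'`, then the initial segments of `chi A` can be recognized in the limit from finite
parts of `B`. -/
theorem TuringLE.exists_approx_pre {A B : Set ℕ} (hT : TuringLE A (jump B)) :
    ∃ E : List ℕ → List ℕ → Prop, PrimrecPred (fun q : List ℕ × List ℕ => E q.1 q.2) ∧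
      (∀ k, ∀ᶠ v in atTop, E (pre (chi B) v) (pre (chi A) k)) ∧
      ∀ τ, τ ≠ pre (chi A) τ.length → ∀ᶠ v in atTop, ¬ E (pre (chi B) v) τ := by
  obtain ⟨E, hE, hpos, hneg⟩ := hT.exists_approx
  refine ⟨fun β τ => ∀ j < τ.length, ∃ y ∈ τ[j]?, E β (j, y), ?_, fun k => ?_, fun τ hτ => ?_⟩
  · refine primrecPred_forall_lt (p := fun (q : List ℕ × List ℕ) j =>
      ∃ y ∈ q.2[j]?, E q.1 (j, y)) (Primrec.list_length.comp Primrec.snd) ?_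
    refine primrecPred_exists_mem_option (p := fun (r : (List ℕ × List ℕ) × ℕ) y =>
      E r.1.1 (r.2, y)) (Primrec.list_getElem?.comp (Primrec.snd.comp Primrec.fst) Primrec.snd) ?_
    exact hE.comp (Primrec.pair (Primrec.fst.comp (Primrec.fst.comp Primrec.fst))
      (Primrec.pair (Primrec.snd.comp Primrec.fst) Primrec.snd))
  · filter_upwards [(eventually_all_finite (Set.finite_lt_nat k)).mpr fun j _ => hpos j] with v hv
    intro j hj
    rw [length_pre] at hj
    exact ⟨_, getElem?_pre (chi A) hj, hv j hj⟩
  · obtain ⟨j, hj, hne⟩ : ∃ j, ∃ hj : j < τ.length, τ[j] ≠ chi A j := by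
      by_contra! hall
      refine hτ (List.ext_getElem (by simp) fun j hj hj' => ?_)
      rw [hall j hj]
      simp [pre]
    filter_upwards [hneg j _ hne] with v hv hE'
    obtain ⟨y, hy, hEy⟩ := hE' j hj
    rw [List.getElem?_eq_getElem hj, Option.mem_some_iff] at hy
    exact hv (hy ▸ hEy)

end Limit

/-! ### The main theorem -/

section Main

/-- The pairs `(σ, τ)` with `τ` of the same length as `σ`, such that `D τ σ` holds and no proper
initial segments satisfy `D`. -/
def Minimal (D : List ℕ → List Bool → Prop) (σ : List Bool) (τ : List ℕ) : Prop :=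
  τ.length = σ.length ∧ D τ σ ∧ ∀ j < σ.length, ¬ D (τ.take j) (σ.take j)

theorem primrecPred_minimal {D : List ℕ → List Bool → Prop}
    (hD : PrimrecPred fun q : List ℕ × List Bool => D q.1 q.2) :
    PrimrecPred fun q : List Bool × List ℕ => Minimal D q.1 q.2 := by
  refine PrimrecPred.and (Primrec.eq.comp (Primrec.list_length.comp Primrec.snd)
    (Primrec.list_length.comp Primrec.fst)) (PrimrecPred.and
      (hD.comp (Primrec.pair Primrec.snd Primrec.fst)) ?_)
  refine primrecPred_forall_lt (p := fun (q : List Bool × List ℕ) j =>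
    ¬ D (q.2.take j) (q.1.take j)) (Primrec.list_length.comp Primrec.fst) (PrimrecPred.not ?_)
  exact hD.comp (Primrec.pair
    (Primrec.list_take.comp Primrec.snd (Primrec.snd.comp Primrec.fst))
    (Primrec.list_take.comp Primrec.snd (Primrec.fst.comp Primrec.fst)))

theorem tsum_minimal_le_one (D : List ℕ → List Bool → Prop) (O : ℕ → ℕ) :
    ∑' σ : {σ | Minimal D σ (pre O σ.length)}, (2⁻¹ : ENNReal) ^ σ.1.length ≤ 1 := by
  rw [← mu_Cyl_eq]
  · exact prob_le_one
  · intro σ hσ σ' hσ' hpre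
    refine hpre.eq_of_length (le_antisymm hpre.length_le (not_lt.mp fun hlt => ?_))
    refine hσ'.2.2 _ hlt ?_
    rw [take_pre O hlt.le, ← List.prefix_iff_eq_take.mp hpre]
    exact hσ.2.1

theorem exists_minimal {D : List ℕ → List Bool → Prop} {O : ℕ → ℕ} {X : ℕ → Bool}
    (h : ∃ n, D (pre O n) (pre X n)) : ∃ n, Minimal D (pre X n) (pre O n) := by
  classical
  refine ⟨Nat.find h, by simp, Nat.find_spec h, fun j hj => ?_⟩
  rw [length_pre] at hj
  rw [take_pre O hj.le, take_pre X hj.le]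
  exact Nat.find_min h hj

/-- The weight function on codes of pairs of strings. -/
def codeLen (i : ℕ) : ℕ :=
  ((Encodable.decode i : Option (List Bool × List ℕ)).map fun q => q.1.length + 1).getD 0

theorem codeLen_encode (q : List Bool × List ℕ) : codeLen (Encodable.encode q) = q.1.length + 1 := by
  rw [codeLen, Encodable.encodek]
  rfl

theorem primrec_codeLen : Primrec codeLen :=
  Primrec.option_getD.comp (Primrec.option_map Primrec.decode
    (Primrec.succ.comp (Primrec.list_length.comp (Primrec.fst.comp Primrec.snd)))) (Primrec.const 0)

theorem LRle.exists_superset_minimal {A B : Set ℕ} (hLR : LRle A B)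
    {D : List ℕ → List Bool → Prop} (hD : PrimrecPred fun q : List ℕ × List Bool => D q.1 q.2) :
    ∃ J : Set (List Bool × List ℕ), CE (chi B) (fun q => q ∈ J) ∧
      (∀ σ, Minimal D σ (pre (chi A) σ.length) → (σ, pre (chi A) σ.length) ∈ J) ∧
      ∑' q : J, (2⁻¹ : ENNReal) ^ q.1.1.length ≠ ⊤ := by
  let g : List Bool → ℕ := fun σ => Encodable.encode (σ, pre (chi A) σ.length)
  have hg : Function.Injective g := fun σ σ' h => congrArg Prod.fst (Encodable.encode_injective h)
  let Z : Set (List Bool) := {σ | Minimal D σ (pre (chi A) σ.length)}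
  have hIA : CE (chi A) fun i => i ∈ g '' Z := by
    refine CE.of_eq (CE.exists' (p := fun (i : ℕ) (q : List Bool × List ℕ) =>
      q.2 = pre (chi A) q.2.length ∧ Minimal D q.1 q.2 ∧ Encodable.encode q = i)
      ((CE.eq_pre.comp (Primrec.snd.comp Primrec.snd)).and (CE.of_primrecPred
        (PrimrecPred.and ((primrecPred_minimal hD).comp Primrec.snd)
          (Primrec.eq.comp (Primrec.encode.comp Primrec.snd) Primrec.fst))))) fun i => ?_
    constructor
    · rintro ⟨⟨σ, τ⟩, hτ, hmin, rfl⟩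
      dsimp only at hτ hmin
      rw [hmin.1] at hτ
      subst hτ
      exact ⟨σ, hmin, rfl⟩
    · rintro ⟨σ, hσ, rfl⟩
      exact ⟨(σ, pre (chi A) σ.length), by simp, hσ, rfl⟩
  obtain ⟨J, hJB, hIJ, hJ⟩ := hLR.exists_superset primrec_codeLen hIA (by
    rw [tsum_image (fun i => (2⁻¹ : ENNReal) ^ codeLen i) hg.injOn]
    simp only [g, codeLen_encode, pow_succ]
    rw [ENNReal.tsum_mul_right]
    exact mul_le_of_le_one_left' (tsum_minimal_le_one D (chi A)))
  refine ⟨{q | Encodable.encode q ∈ J}, hJB.comp Primrec.encode, fun σ hσ => hIJ ⟨σ, hσ, rfl⟩, ?_⟩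
  have h1 : ∀ q : {q : List Bool × List ℕ | Encodable.encode q ∈ J},
      (2⁻¹ : ENNReal) ^ q.1.1.length = 2 * 2⁻¹ ^ codeLen (Encodable.encode q.1) := by
    intro q
    rw [codeLen_encode, pow_succ', ← mul_assoc, ENNReal.mul_inv_cancel two_ne_zero
      ENNReal.ofNat_ne_top, one_mul]
  rw [tsum_congr h1, ENNReal.tsum_mul_left]
  refine ENNReal.mul_ne_top ENNReal.ofNat_ne_top (ne_top_of_le_ne_top hJ ?_)
  exact ENNReal.tsum_comp_le_tsum_of_injective
    (f := fun q : {q : List Bool × List ℕ | Encodable.encode q ∈ J} =>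
      (⟨Encodable.encode q.1, q.2⟩ : J))
    (fun q q' h => Subtype.ext (Encodable.encode_injective (congrArg Subtype.val h)))
    fun i : J => (2⁻¹ : ENNReal) ^ codeLen i.1

end Main

/-- If `A ≤_T B′` and `A ≤_LR B`, then every `Π^A_1` class has a `Σ^B_2` subclass of the
same measure. -/
theorem pi1_subclass_of_le_jump_of_LR (A B : Set ℕ)
    (hT : TuringLE A (jump B)) (hLR : LRle A B) :
    ∀ P : Set (ℕ → Bool), Pi1In A P →
      ∃ Q : Set (ℕ → Bool), Sigma2In B Q ∧ Q ⊆ P ∧ mu Q = mu P := by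
  rintro _ ⟨W, hW, rfl⟩
  obtain ⟨D, hD, hDm, hWD⟩ := (ceIn_iff.mp hW).exists_monotone
  obtain ⟨J, hJB, hJ, hJsum⟩ := hLR.exists_superset_minimal hD
  obtain ⟨E, hE, hpos, hneg⟩ := hT.exists_approx_pre
  let V : ℕ → Set (List Bool) := fun n => {σ | ∃ r : List ℕ × List ℕ, ((σ, r.1) ∈ J ∧
    r.2 = pre (chi B) r.2.length) ∧ Minimal D σ r.1 ∧ n ≤ r.2.length ∧ E r.2 r.1}
  have hV : CeSeqIn B V := by
    refine ceSeqIn_iff.mpr (CE.exists' (p := fun (q : ℕ × List Bool) (r : List ℕ × List ℕ) =>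
      ((q.2, r.1) ∈ J ∧ r.2 = pre (chi B) r.2.length) ∧ Minimal D q.2 r.1 ∧ q.1 ≤ r.2.length ∧
        E r.2 r.1) ?_)
    have h1 : Primrec fun x : (ℕ × List Bool) × List ℕ × List ℕ => (x.1.2, x.2.1) :=
      Primrec.pair (Primrec.snd.comp Primrec.fst) (Primrec.fst.comp Primrec.snd)
    refine ((hJB.comp h1).and (CE.eq_pre.comp (Primrec.snd.comp Primrec.snd))).and
      (CE.of_primrecPred (PrimrecPred.and ((primrecPred_minimal hD).comp h1)
        (PrimrecPred.and ?_ (hE.comp (Primrec.pair (Primrec.snd.comp Primrec.snd)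
          (Primrec.fst.comp Primrec.snd))))))
    exact Primrec.nat_le.comp (Primrec.fst.comp Primrec.fst)
      (Primrec.list_length.comp (Primrec.snd.comp Primrec.snd))
  have hWV : ∀ n, Cyl W ⊆ Cyl (V n) := by
    intro n X hX
    obtain ⟨k, hk⟩ := exists_minimal ((hWD X).mp hX)
    obtain ⟨v, hnv, hv⟩ := ((eventually_ge_atTop n).and (hpos k)).exists
    have hkJ := hJ (pre X k)
    rw [length_pre] at hkJ
    exact mem_Cyl.mpr ⟨pre X k, ⟨(pre (chi A) k, pre (chi B) v), ⟨hkJ hk, by simp⟩, hk,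
      by simpa using hnv, hv⟩, by simp [mem_cyl]⟩
  have hsub : (⋃ n, (Cyl (V n))ᶜ) ⊆ (Cyl W)ᶜ :=
    Set.iUnion_subset fun n => Set.compl_subset_compl.mpr (hWV n)
  refine ⟨⋃ n, (Cyl (V n))ᶜ, ⟨V, hV, rfl⟩, hsub, measure_congr (ae_eq_set.mpr
    ⟨by rw [Set.sdiff_eq_empty.mpr hsub, measure_empty], ?_⟩)⟩
  have hfin : ∀ᵐ X ∂mu, {q : J | X ∈ cyl q.1.1}.Finite :=
    ae_finite_setOfPred_mem (by simpa only [mu_cyl] using hJsum)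
  refine measure_mono_null (fun X hX => ?_) hfin
  rintro hXfin
  have hev : ∀ᶠ n in atTop, ∀ q ∈ {q : J | X ∈ cyl q.1.1},
      q.1.2 ≠ pre (chi A) q.1.2.length → ∀ v ≥ n, ¬ E (pre (chi B) v) q.1.2 := by
    refine (eventually_all_finite hXfin).mpr fun q _ => ?_
    by_cases hq : q.1.2 = pre (chi A) q.1.2.length
    · exact Eventually.of_forall fun n h => absurd hq h
    · obtain ⟨N, hN⟩ := eventually_atTop.mp (hneg _ hq)
      filter_upwards [eventually_ge_atTop N] with n hn _ v hv
      exact hN v (hn.trans hv)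
  obtain ⟨n, hn⟩ := hev.exists
  have hXV : X ∈ Cyl (V n) := by
    by_contra h
    exact hX.2 (Set.mem_iUnion.mpr ⟨n, h⟩)
  obtain ⟨σ, ⟨⟨τ, β⟩, ⟨hστ, hβ⟩, hmin, hnβ, hEβ⟩, hXσ⟩ := mem_Cyl.mp hXV
  dsimp only at hστ hβ hmin hnβ hEβ
  by_cases hτ : τ = pre (chi A) τ.length
  · refine hX.1 ((hWD X).mpr ⟨σ.length, ?_⟩)
    rw [mem_cyl.mp hXσ, ← hmin.1, ← hτ]
    exact hmin.2.1
  · refine hn ⟨(σ, τ), hστ⟩ hXσ hτ β.length hnβ ?_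
    rwa [← hβ]

end LMD
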